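/- Fix δ₀ ∈ (0,1) and δ₀ < |E| < 2 − δ₀. There are constants C > 0 and λ₀ > 0 such that for 0 < λ < λ₀ the following holds, with N = ⌈λ^{−2}⌉. Let h ∈ SL₂(ℝ) be any matrix with λ^{−1/10} ≤ ‖h‖ ≤ 2 λ^{−1/10}, and let I be any arc of the circle with |I| < λ. Then ∫ (τ_{M_N(E;ε) h})_*[ν](I) dε ≤ e^{C |log λ|^{1/2}} { max_{|J| < λ^{1/10}|I|} ν(J) + λ^{1/30} max_{|J| ≤ |I|} ν(J) + max_{λ^{−1/10} < D < λ^{−1/5}} (1/D) max_{|J| < D|I|} ν(J) }, where J ranges over arcs of the circle and dε is the uniform measure on {1,−1}^N. -/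

import Mathlib

open MeasureTheory

noncomputable section

instance : Fact (0 < 2 * Real.pi) := ⟨by have := Real.pi_pos; linarith⟩

/-- Operator norm of a `2 × 2` real matrix acting on Euclidean `ℝ²`. -/
def opNorm (g : Matrix (Fin 2) (Fin 2) ℝ) : ℝ :=
  ‖Matrix.toEuclideanCLM (𝕜 := ℝ) g‖

/-- Single-step Anderson–Bernoulli matrix `g_E(ε) = [[E - λε, -1],[1,0]]`. -/
def gE (lam E x : ℝ) : Matrix (Fin 2) (Fin 2) ℝ := !![E - lam * x, -1; 1, 0]

/-- Transfer matrix `M_N(E;ε) = g_E(ε_N) ⋯ g_E(ε_1)`. -/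
def transfer (lam E : ℝ) (N : ℕ) (eps : Fin N → ℝ) : Matrix (Fin 2) (Fin 2) ℝ :=
  ((List.ofFn fun j => gE lam E (eps j)).reverse).prod

/-- `±1`-value of a Boolean (`true ↔ 1`, `false ↔ -1`). -/
def bval (b : Bool) : ℝ := if b then 1 else -1

/-- Transfer matrix with Bernoulli `±1` entries, cube encoded as `Fin N → Bool`. -/
def transferB (lam E : ℝ) (N : ℕ) (σ : Fin N → Bool) : Matrix (Fin 2) (Fin 2) ℝ :=
  transfer lam E N fun j => bval (σ j)

/-- The projective action `τ_g(θ)` of `g ∈ SL₂(ℝ)`, as a point of the circle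
`ℝ/2πℤ`: the argument of `(a cos θ + b sin θ) + i (c cos θ + d sin θ)`. -/
def tauC (g : Matrix (Fin 2) (Fin 2) ℝ) (θ : ℝ) : AddCircle (2 * Real.pi) :=
  ((Complex.arg ((g 0 0 * Real.cos θ + g 0 1 * Real.sin θ : ℝ) +
      Complex.I * (g 1 0 * Real.cos θ + g 1 1 * Real.sin θ : ℝ)) : ℝ) :
    AddCircle (2 * Real.pi))

/-- The projective action of `g` as a self-map of the circle `ℝ/2πℤ`. -/
def tauMap (g : Matrix (Fin 2) (Fin 2) ℝ) :
    AddCircle (2 * Real.pi) → AddCircle (2 * Real.pi) :=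
  AddCircle.liftIco (2 * Real.pi) 0 fun θ => tauC g θ

/-- The arc of the circle `ℝ/2πℤ` obtained by projecting the interval `(a, a+l)`. -/
def arc (a l : ℝ) : Set (AddCircle (2 * Real.pi)) :=
  (fun θ : ℝ => (θ : AddCircle (2 * Real.pi))) '' Set.Ioo a (a + l)

/-- `max_{|J| < s} ν(J)` over arcs `J` of the circle. -/
def arcSupLt (ν : Measure (AddCircle (2 * Real.pi))) (s : ℝ) : ENNReal :=
  ⨆ (a : ℝ) (l : ℝ) (_ : l < s), ν (arc a l)

/-- `max_{|J| ≤ s} ν(J)` over arcs `J` of the circle. -/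
def arcSupLe (ν : Measure (AddCircle (2 * Real.pi))) (s : ℝ) : ENNReal :=
  ⨆ (a : ℝ) (l : ℝ) (_ : l ≤ s), ν (arc a l)

/-- `ν` is stationary for `μ_{λ,E} = ½ δ_{g_E(1)} + ½ δ_{g_E(-1)}`
(the defining property of the Furstenberg measure `ν_E^{(λ)}`). -/
def Stationary (lam E : ℝ) (ν : Measure (AddCircle (2 * Real.pi))) : Prop :=
  ∀ s : Set (AddCircle (2 * Real.pi)), MeasurableSet s →
    ν s = (ν (tauMap (gE lam E 1) ⁻¹' s) + ν (tauMap (gE lam E (-1)) ⁻¹' s)) / 2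

section Orbits

/-- The orbit of `p` under the one-step maps with potential `ε`. -/
def orb (lam E : ℝ) (ε : ℕ → ℝ) (p : ℝ × ℝ) : ℕ → ℝ × ℝ
  | 0 => p
  | n + 1 => ((E - lam * ε n) * (orb lam E ε p n).1 - (orb lam E ε p n).2, (orb lam E ε p n).1)

/-- The square of the Hilbert–Schmidt norm of the `n`-step transfer matrix. -/
def hsq (lam E : ℝ) (ε : ℕ → ℝ) (n : ℕ) : ℝ :=
  (orb lam E ε (1, 0) n).1 ^ 2 + (orb lam E ε (1, 0) n).2 ^ 2 +
    (orb lam E ε (0, 1) n).1 ^ 2 + (orb lam E ε (0, 1) n).2 ^ 2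

variable {lam E : ℝ} {ε ε' : ℕ → ℝ} {p : ℝ × ℝ} {K : ℝ}

lemma orb_congr {N : ℕ} (h : ∀ n < N, ε n = ε' n) {n : ℕ} (hn : n ≤ N) :
    orb lam E ε p n = orb lam E ε' p n := by
  induction n with
  | zero => rfl
  | succ n ih => simp only [orb, ih (by omega), h n (by omega)]

lemma orb_eq_combination (n : ℕ) :
    orb lam E ε p n = p.1 • orb lam E ε (1, 0) n + p.2 • orb lam E ε (0, 1) n := by
  induction n with
  | zero => ext <;> simp [orb]
  | succ n ih =>
    simp only [orb, ih]
    ext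
    · simp; ring
    · simp

lemma orb_det (n : ℕ) :
    (orb lam E ε (1, 0) n).1 * (orb lam E ε (0, 1) n).2 -
      (orb lam E ε (1, 0) n).2 * (orb lam E ε (0, 1) n).1 = 1 := by
  induction n with
  | zero => simp [orb]
  | succ n ih => simp only [orb]; linarith

lemma one_le_hsq (n : ℕ) : 1 ≤ hsq lam E ε n := by
  have h := orb_det (lam := lam) (E := E) (ε := ε) n
  unfold hsq
  nlinarith [sq_nonneg ((orb lam E ε (1, 0) n).1 - (orb lam E ε (0, 1) n).2),
    sq_nonneg ((orb lam E ε (1, 0) n).2 + (orb lam E ε (0, 1) n).1)]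

lemma normSq_le_hsq_mul_orb (n : ℕ) :
    p.1 ^ 2 + p.2 ^ 2 ≤
      hsq lam E ε n * ((orb lam E ε p n).1 ^ 2 + (orb lam E ε p n).2 ^ 2) := by
  have h := orb_det (lam := lam) (E := E) (ε := ε) n
  have hc := orb_eq_combination (lam := lam) (E := E) (ε := ε) (p := p) n
  set v := orb lam E ε p n
  unfold hsq
  set a := orb lam E ε (1, 0) n
  set b := orb lam E ε (0, 1) n
  have h1 : v.1 = p.1 * a.1 + p.2 * b.1 := by rw [hc]; simp
  have h2 : v.2 = p.1 * a.2 + p.2 * b.2 := by rw [hc]; simp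
  have e1 : p.1 = v.1 * b.2 - v.2 * b.1 := by
    rw [h1, h2]; linear_combination (-p.1) * h
  have e2 : p.2 = a.1 * v.2 - a.2 * v.1 := by
    rw [h1, h2]; linear_combination (-p.2) * h
  rw [e1, e2]
  nlinarith [sq_nonneg (v.1 * b.1 + v.2 * b.2), sq_nonneg (a.1 * v.1 + a.2 * v.2)]

lemma orb_normSq_le (n : ℕ) :
    (orb lam E ε p n).1 ^ 2 + (orb lam E ε p n).2 ^ 2 ≤
      hsq lam E ε n * (p.1 ^ 2 + p.2 ^ 2) := by
  have hc := orb_eq_combination (lam := lam) (E := E) (ε := ε) (p := p) n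
  set v := orb lam E ε p n
  unfold hsq
  set a := orb lam E ε (1, 0) n
  set b := orb lam E ε (0, 1) n
  have h1 : v.1 = p.1 * a.1 + p.2 * b.1 := by rw [hc]; simp
  have h2 : v.2 = p.1 * a.2 + p.2 * b.2 := by rw [hc]; simp
  rw [h1, h2]
  nlinarith [sq_nonneg (p.1 * b.1 - p.2 * a.1), sq_nonneg (p.1 * b.2 - p.2 * a.2)]

/-- The Wronskian of two orbits changes in one step by the difference of the potentials. -/
lemma wronskian_succ (p p' : ℝ × ℝ) (n : ℕ) :
    (orb lam E ε p (n + 1)).1 * (orb lam E ε' p' (n + 1)).2 -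
        (orb lam E ε p (n + 1)).2 * (orb lam E ε' p' (n + 1)).1 =
      (orb lam E ε p n).1 * (orb lam E ε' p' n).2 -
        (orb lam E ε p n).2 * (orb lam E ε' p' n).1 +
      lam * (ε' n - ε n) * ((orb lam E ε p n).1 * (orb lam E ε' p' n).1) := by
  simp only [orb]; ring

lemma abs_mul_add_le {α β x y K : ℝ} (hx : |x| ≤ K) (hy : |y| ≤ K) :
    |α * x + β * y| ≤ K * (|α| + |β|) := by
  refine (abs_add_le _ _).trans ?_
  rw [abs_mul, abs_mul]
  nlinarith [mul_le_mul_of_nonneg_left hx (abs_nonneg α),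
    mul_le_mul_of_nonneg_left hy (abs_nonneg β)]

lemma inner_ge_of_close {x y x' y' : ℝ}
    (h : (x' - x) ^ 2 + (y' - y) ^ 2 ≤ (x ^ 2 + y ^ 2) / 4) :
    (x ^ 2 + y ^ 2) / 2 ≤ x * x' + y * y' := by
  nlinarith [sq_nonneg (x / 2 + (x' - x)), sq_nonneg (y / 2 + (y' - y))]

lemma combination_normSq_le (α β x y z w : ℝ) :
    (α * x + β * z) ^ 2 + (α * y + β * w) ^ 2 ≤
      (x ^ 2 + y ^ 2 + z ^ 2 + w ^ 2) * (α ^ 2 + β ^ 2) := by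
  nlinarith [sq_nonneg (α * z - β * x), sq_nonneg (α * w - β * y)]

/-- Coordinates, in the fundamental system of `ε`, of an orbit for another potential `ε'`. -/
lemma coordinates_perturbation {N : ℕ} (hlam : 0 ≤ lam) (hK : ∀ n ≤ N, hsq lam E ε n ≤ K)
    {n : ℕ} (hn : n ≤ N) :
    (|((orb lam E ε' p n).1 * (orb lam E ε (0, 1) n).2 -
          (orb lam E ε' p n).2 * (orb lam E ε (0, 1) n).1) - p.1| +
      |((orb lam E ε (1, 0) n).1 * (orb lam E ε' p n).2 -
          (orb lam E ε (1, 0) n).2 * (orb lam E ε' p n).1) - p.2|) + (|p.1| + |p.2|) ≤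
      Real.exp (2 * K * lam * ∑ j ∈ Finset.range n, |ε' j - ε j|) * (|p.1| + |p.2|) := by
  induction n with
  | zero => simp [orb]
  | succ n ih =>
    have ih := ih (by omega)
    have hKn := hK n (by omega)
    have h := orb_det (lam := lam) (E := E) (ε := ε) n
    have w1 := wronskian_succ (lam := lam) (E := E) (ε := ε') (ε' := ε) p (0, 1) n
    have w2 := wronskian_succ (lam := lam) (E := E) (ε := ε) (ε' := ε') (1, 0) p n
    rw [w1, w2, Finset.sum_range_succ, mul_add (2 * K * lam), Real.exp_add]
    unfold hsq at hKn
    set v := orb lam E ε' p n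
    set a := orb lam E ε (1, 0) n
    set b := orb lam E ε (0, 1) n
    set S := Real.exp (2 * K * lam * ∑ j ∈ Finset.range n, |ε' j - ε j|)
    set α := v.1 * b.2 - v.2 * b.1 with hα
    set β := a.1 * v.2 - a.2 * v.1 with hβ
    set Δ := |ε' n - ε n| with hΔ
    have hv : v.1 = α * a.1 + β * b.1 := by
      rw [hα, hβ]; linear_combination (-v.1) * h
    have hab : |a.1 * b.1| ≤ K := by
      rw [abs_le]; constructor <;>
        nlinarith [sq_nonneg (a.1 + b.1), sq_nonneg (a.1 - b.1), sq_nonneg a.2, sq_nonneg b.2]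
    have haa : |a.1 * a.1| ≤ K := by
      rw [abs_of_nonneg (mul_self_nonneg _)]
      nlinarith [sq_nonneg b.1, sq_nonneg a.2, sq_nonneg b.2]
    have hbb : |b.1 * b.1| ≤ K := by
      rw [abs_of_nonneg (mul_self_nonneg _)]
      nlinarith [sq_nonneg a.1, sq_nonneg a.2, sq_nonneg b.2]
    have hK0 : 0 ≤ K := (abs_nonneg _).trans haa
    have hΔ0 : 0 ≤ Δ := abs_nonneg _
    have hvb : |v.1 * b.1| ≤ K * (|α| + |β|) := by
      have : v.1 * b.1 = α * (a.1 * b.1) + β * (b.1 * b.1) := by rw [hv]; ring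
      rw [this]
      exact abs_mul_add_le hab hbb
    have hva : |a.1 * v.1| ≤ K * (|α| + |β|) := by
      have : a.1 * v.1 = α * (a.1 * a.1) + β * (a.1 * b.1) := by rw [hv]; ring
      rw [this]
      exact abs_mul_add_le haa hab
    have t1 : |α + lam * (ε n - ε' n) * (v.1 * b.1) - p.1| ≤
        |α - p.1| + lam * Δ * (K * (|α| + |β|)) := by
      have : α + lam * (ε n - ε' n) * (v.1 * b.1) - p.1 =
        (α - p.1) + lam * (ε n - ε' n) * (v.1 * b.1) := by ring
      rw [this]
      refine (abs_add_le _ _).trans ?_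
      rw [abs_mul (lam * _), abs_mul, abs_of_nonneg hlam, abs_sub_comm (ε n), ← hΔ]
      gcongr
    have t2 : |β + lam * (ε' n - ε n) * (a.1 * v.1) - p.2| ≤
        |β - p.2| + lam * Δ * (K * (|α| + |β|)) := by
      have : β + lam * (ε' n - ε n) * (a.1 * v.1) - p.2 =
        (β - p.2) + lam * (ε' n - ε n) * (a.1 * v.1) := by ring
      rw [this]
      refine (abs_add_le _ _).trans ?_
      rw [abs_mul (lam * _), abs_mul, abs_of_nonneg hlam, ← hΔ]
      gcongr
    have hαp : |α| ≤ |α - p.1| + |p.1| := by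
      simpa using abs_add_le (α - p.1) p.1
    have hβp : |β| ≤ |β - p.2| + |p.2| := by
      simpa using abs_add_le (β - p.2) p.2
    set x := 2 * K * lam * Δ with hx
    have hx0 : 0 ≤ x := by positivity
    have hexp : x + 1 ≤ Real.exp x := Real.add_one_le_exp x
    set e := |α - p.1| + |β - p.2| + (|p.1| + |p.2|) with he
    have he0 : 0 ≤ e := by positivity
    calc _ ≤ e + x * (|α| + |β|) := by
            have : x * (|α| + |β|) = 2 * (lam * Δ * (K * (|α| + |β|))) := by rw [hx]; ring
            rw [this]; linarith
      _ ≤ e + x * e := by gcongr; linarith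
      _ = (x + 1) * e := by ring
      _ ≤ Real.exp x * (S * (|p.1| + |p.2|)) := by gcongr
      _ = _ := by ring

/-- Orbits of close potentials stay close, relative to their size. -/
lemma half_normSq_le_inner {N : ℕ} (hlam : 0 ≤ lam) (hK : ∀ n ≤ N, hsq lam E ε n ≤ K)
    (hs : 12 * K ^ 2 * lam * ∑ j ∈ Finset.range N, |ε' j - ε j| ≤ 1)
    {n : ℕ} (hn : n ≤ N) :
    (p.1 ^ 2 + p.2 ^ 2) / (2 * K) ≤
      (orb lam E ε p n).1 * (orb lam E ε' p n).1 +
        (orb lam E ε p n).2 * (orb lam E ε' p n).2 := by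
  have hpert := coordinates_perturbation (ε' := ε') (p := p) hlam hK hn
  have hKn := hK n hn
  have hK1 : 1 ≤ K := (one_le_hsq n).trans hKn
  have hlow := normSq_le_hsq_mul_orb (lam := lam) (E := E) (ε := ε) (p := p) n
  have hc := orb_eq_combination (lam := lam) (E := E) (ε := ε) (p := p) n
  have h := orb_det (lam := lam) (E := E) (ε := ε) n
  set s := 2 * K * lam * ∑ j ∈ Finset.range n, |ε' j - ε j| with hs_def
  have hs0 : 0 ≤ s := by positivity
  have hs1 : 6 * K * s ≤ 1 := by
    refine le_trans ?_ hs
    have : 6 * K * s = 12 * K ^ 2 * lam * ∑ j ∈ Finset.range n, |ε' j - ε j| := by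
      rw [hs_def]; ring
    rw [this]
    gcongr
  have hs2 : s ≤ 1 / 6 := by nlinarith
  have hexp : Real.exp s ≤ 1 + 2 * s := by
    have := Real.exp_bound' hs0 (by linarith : s ≤ 1) (n := 1) (by norm_num)
    norm_num at this
    linarith
  set v := orb lam E ε p n
  set v' := orb lam E ε' p n
  have hpos : 0 ≤ v.1 ^ 2 + v.2 ^ 2 := by positivity
  have hlow2 : p.1 ^ 2 + p.2 ^ 2 ≤ K * (v.1 ^ 2 + v.2 ^ 2) :=
    hlow.trans (mul_le_mul_of_nonneg_right hKn hpos)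
  unfold hsq at hKn
  set a := orb lam E ε (1, 0) n
  set b := orb lam E ε (0, 1) n
  set α := v'.1 * b.2 - v'.2 * b.1 with hα
  set β := a.1 * v'.2 - a.2 * v'.1 with hβ
  have d1 : v'.1 - v.1 = (α - p.1) * a.1 + (β - p.2) * b.1 := by
    have : v.1 = p.1 * a.1 + p.2 * b.1 := by rw [hc]; simp
    rw [this, hα, hβ]; linear_combination (-v'.1) * h
  have d2 : v'.2 - v.2 = (α - p.1) * a.2 + (β - p.2) * b.2 := by
    have : v.2 = p.1 * a.2 + p.2 * b.2 := by rw [hc]; simp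
    rw [this, hα, hβ]; linear_combination (-v'.2) * h
  set A := |α - p.1|
  set B := |β - p.2|
  have hA : (α - p.1) ^ 2 = A ^ 2 := (sq_abs _).symm
  have hB : (β - p.2) ^ 2 = B ^ 2 := (sq_abs _).symm
  have hA0 : 0 ≤ A := abs_nonneg _
  have hB0 : 0 ≤ B := abs_nonneg _
  have hpp : (|p.1| + |p.2|) ^ 2 ≤ 2 * (p.1 ^ 2 + p.2 ^ 2) := by
    simpa [sq_abs] using add_sq_le (a := |p.1|) (b := |p.2|)
  have hAB : A + B ≤ 2 * s * (|p.1| + |p.2|) := by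
    have : Real.exp s * (|p.1| + |p.2|) ≤ (1 + 2 * s) * (|p.1| + |p.2|) := by gcongr
    linarith
  have hAB2 : A ^ 2 + B ^ 2 ≤ 8 * s ^ 2 * (p.1 ^ 2 + p.2 ^ 2) := by
    calc A ^ 2 + B ^ 2 ≤ (A + B) ^ 2 := by linarith [mul_nonneg hA0 hB0, add_sq A B]
      _ ≤ (2 * s * (|p.1| + |p.2|)) ^ 2 := by gcongr
      _ = 4 * s ^ 2 * (|p.1| + |p.2|) ^ 2 := by ring
      _ ≤ 4 * s ^ 2 * (2 * (p.1 ^ 2 + p.2 ^ 2)) := by gcongr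
      _ = _ := by ring
  have hdiff : (v'.1 - v.1) ^ 2 + (v'.2 - v.2) ^ 2 ≤ (v.1 ^ 2 + v.2 ^ 2) / 4 := by
    calc (v'.1 - v.1) ^ 2 + (v'.2 - v.2) ^ 2
        ≤ (a.1 ^ 2 + a.2 ^ 2 + b.1 ^ 2 + b.2 ^ 2) * (A ^ 2 + B ^ 2) := by
          rw [d1, d2, ← hA, ← hB]
          exact combination_normSq_le _ _ _ _ _ _
      _ ≤ K * (8 * s ^ 2 * (K * (v.1 ^ 2 + v.2 ^ 2))) := by
          gcongr
          exact hAB2.trans (by gcongr)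
      _ = 8 * (K * s) ^ 2 * (v.1 ^ 2 + v.2 ^ 2) := by ring
      _ ≤ 8 * (1 / 6) ^ 2 * (v.1 ^ 2 + v.2 ^ 2) := by
          gcongr
          linarith
      _ ≤ _ := by linarith
  have hinner : (v.1 ^ 2 + v.2 ^ 2) / 2 ≤ v.1 * v'.1 + v.2 * v'.2 := inner_ge_of_close hdiff
  refine le_trans ?_ hinner
  rw [div_le_div_iff₀ (by positivity) (by norm_num)]
  linarith

end Orbits

section Combinatorics

lemma centralBinom_sq_le (n : ℕ) : (n.centralBinom) ^ 2 * (2 * n + 1) ≤ 16 ^ n := by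
  induction n with
  | zero => simp
  | succ n ih =>
    have h := Nat.succ_mul_centralBinom_succ n
    have h2 : (n + 1) ^ 2 * ((n + 1).centralBinom ^ 2 * (2 * (n + 1) + 1)) ≤
        (n + 1) ^ 2 * 16 ^ (n + 1) := by
      calc (n + 1) ^ 2 * ((n + 1).centralBinom ^ 2 * (2 * (n + 1) + 1))
          = ((n + 1) * (n + 1).centralBinom) ^ 2 * (2 * n + 3) := by ring
        _ = 4 * (2 * n + 1) * (2 * n + 3) * (n.centralBinom ^ 2 * (2 * n + 1)) := by
            rw [h]; ring
        _ ≤ 4 * (2 * n + 1) * (2 * n + 3) * 16 ^ n := by gcongr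
        _ ≤ (16 * (n + 1) ^ 2) * 16 ^ n := by
            refine Nat.mul_le_mul_right _ ?_
            nlinarith
        _ = _ := by ring
    exact Nat.le_of_mul_le_mul_left h2 (by positivity)

lemma centralBinom_le_div_sqrt (n : ℕ) :
    (n.centralBinom : ℝ) ≤ 4 ^ n / √(2 * n + 1) := by
  have h : ((n.centralBinom : ℝ)) ^ 2 * (2 * n + 1) ≤ (4 ^ n) ^ 2 := by
    have := centralBinom_sq_le n
    rw [← pow_mul, mul_comm n 2, pow_mul]
    norm_num
    exact_mod_cast this
  rw [le_div_iff₀ (by positivity)]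
  refine (sq_le_sq₀ (by positivity) (by positivity)).1 ?_
  rw [mul_pow, Real.sq_sqrt (by positivity)]
  exact h

lemma choose_half_le (n : ℕ) : (n.choose (n / 2) : ℝ) ≤ 2 ^ n / √(n + 1) := by
  obtain ⟨k, rfl | rfl⟩ := n.even_or_odd'
  · have := centralBinom_le_div_sqrt k
    rw [Nat.mul_div_cancel_left k (by norm_num), pow_mul]
    rw [Nat.centralBinom] at this
    push_cast
    norm_num at this ⊢
    exact this
  · have h := centralBinom_le_div_sqrt (k + 1)
    have h2 : (k + 1).centralBinom = 2 * (2 * k + 1).choose k := by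
      rw [Nat.centralBinom, show 2 * (k + 1) = (2 * k + 1) + 1 by ring, Nat.choose_succ_succ,
        Nat.choose_symm_half]
      ring
    rw [show (2 * k + 1) / 2 = k by omega]
    rw [h2] at h
    have h3 : (4 : ℝ) ^ (k + 1) / √(2 * ((k + 1 : ℕ) : ℝ) + 1) ≤
        2 * (2 ^ (2 * k + 1) / √(((2 * k + 1 : ℕ) : ℝ) + 1)) := by
      rw [← mul_div_assoc]
      have : (4 : ℝ) ^ (k + 1) = 2 * 2 ^ (2 * k + 1) := by
        rw [pow_succ, pow_succ, pow_mul]; norm_num; ring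
      rw [this]
      gcongr
      push_cast
      linarith
    push_cast at h h3 ⊢
    linarith

/-- A family whose comparable members, when at distance at most `T`, are at distance at most `k`,
is a union of few antichains. -/
lemma card_le_of_short_chains {α : Type*} [Fintype α] [DecidableEq α] (𝓕 : Finset (Finset α))
    {lo R T k : ℕ} (hT : 0 < T) (hlev : ∀ A ∈ 𝓕, lo ≤ A.card ∧ A.card ≤ lo + R)
    (hgap : ∀ A ∈ 𝓕, ∀ B ∈ 𝓕, A ⊆ B → B.card ≤ A.card + T → B.card ≤ A.card + k) :
    𝓕.card ≤ (Fintype.card α).choose (Fintype.card α / 2) * ((R / T + 1) * (k + 1)) := by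
  set f : Finset α → ℕ × ℕ := fun A => ((A.card - lo) / T, A.card % (k + 1)) with hf
  refine (Finset.card_le_mul_card_image (f := f) 𝓕 _ ?_).trans
    (Nat.mul_le_mul_left _ ?_)
  · intro b _
    refine IsAntichain.sperner ?_
    intro A hA B hB hne hAB
    simp only [Finset.coe_filter, Set.mem_ofPred_eq] at hA hB
    have hsub : A ⊆ B := hAB
    have hfe : f A = f B := hA.2.trans hB.2.symm
    simp only [hf, Prod.mk.injEq] at hfe
    obtain ⟨h1, h2⟩ := hfe
    have hc := Finset.card_le_card hsub
    have hlA := hlev A hA.1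
    have hlB := hlev B hB.1
    have hTd : B.card ≤ A.card + T := by
      have e1 := Nat.div_add_mod (A.card - lo) T
      have e2 := Nat.div_add_mod (B.card - lo) T
      have e3 := Nat.mod_lt (B.card - lo) hT
      rw [h1] at e1
      omega
    have hkd := hgap A hA.1 B hB.1 hsub hTd
    have hmod : (B.card - A.card) % (k + 1) = 0 :=
      Nat.sub_mod_eq_zero_of_mod_eq h2.symm
    rw [Nat.mod_eq_of_lt (by omega)] at hmod
    exact hne (Finset.eq_of_subset_of_card_le hsub (by omega))
  · have : Finset.image f 𝓕 ⊆ Finset.range (R / T + 1) ×ˢ Finset.range (k + 1) := by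
      intro x hx
      obtain ⟨A, hA, rfl⟩ := Finset.mem_image.1 hx
      have := hlev A hA
      simp only [hf, Finset.mem_product, Finset.mem_range]
      refine ⟨Nat.lt_succ_of_le (Nat.div_le_div_right (by omega)), Nat.mod_lt _ (by omega)⟩
    simpa using Finset.card_le_card this

lemma card_upper_tail_le {α : Type*} [Fintype α] [DecidableEq α] {L M : ℝ}
    (hM : 0 < M) (hn : (Fintype.card α : ℝ) ≤ M) (s : ℝ) (hs : s = 1 ∨ s = -1) :
    (({A : Finset α | L < s * (2 * A.card - Fintype.card α)} : Finset (Finset α)).card : ℝ) ≤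
      2 ^ Fintype.card α * Real.exp (-(L ^ 2 / (2 * M))) ∨ L < 0 := by
  refine or_iff_not_imp_right.2 fun hL => ?_
  push Not at hL
  set n := Fintype.card α with hn_def
  set t := L / M with ht
  have ht0 : 0 ≤ t := by positivity
  have hsum : ∑ A : Finset α, Real.exp (t * (s * (2 * A.card - n))) =
      (Real.exp (t * s) + Real.exp (-(t * s))) ^ n := by
    rw [← Fintype.sum_pow_mul_eq_add_pow α]
    refine Finset.sum_congr rfl fun A _ => ?_
    rw [← Real.exp_nat_mul, ← Real.exp_nat_mul, ← Real.exp_add,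
      Nat.cast_sub (Finset.card_le_univ A)]
    congr 1
    ring
  have hcosh : Real.exp (t * s) + Real.exp (-(t * s)) ≤ 2 * Real.exp (t ^ 2 / 2) := by
    have h := Real.cosh_le_exp_half_sq (t * s)
    rw [Real.cosh_eq] at h
    have : (t * s) ^ 2 = t ^ 2 := by rcases hs with rfl | rfl <;> ring
    rw [this] at h
    linarith
  have hmarkov : (({A : Finset α | L < s * (2 * A.card - n)} :
      Finset (Finset α)).card : ℝ) * Real.exp (t * L) ≤
        ∑ A : Finset α, Real.exp (t * (s * (2 * A.card - n))) := by
    rw [← nsmul_eq_mul, ← Finset.sum_const]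
    refine (Finset.sum_le_sum fun A hA => ?_).trans
      (Finset.sum_le_sum_of_subset_of_nonneg (Finset.subset_univ _) fun _ _ _ =>
        (Real.exp_pos _).le)
    have hA' : L < s * (2 * A.card - n) := by simpa using hA
    gcongr
  rw [hsum] at hmarkov
  have h1 : (Real.exp (t * s) + Real.exp (-(t * s))) ^ n ≤
      2 ^ n * Real.exp (n * (t ^ 2 / 2)) := by
    rw [Real.exp_nat_mul, ← mul_pow]
    gcongr
  have h2 : 2 ^ n * Real.exp (n * (t ^ 2 / 2)) ≤
      2 ^ n * Real.exp (-(L ^ 2 / (2 * M))) * Real.exp (t * L) := by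
    rw [mul_assoc, ← Real.exp_add]
    gcongr
    have : (n : ℝ) * (t ^ 2 / 2) ≤ M * (t ^ 2 / 2) := by gcongr
    refine this.trans (le_of_eq ?_)
    rw [ht]
    field_simp
    ring
  exact le_of_mul_le_mul_right (hmarkov.trans (h1.trans h2)) (Real.exp_pos _)

lemma card_short_chains_le {α : Type*} [Fintype α] [DecidableEq α] (𝓕 : Finset (Finset α))
    {T k : ℕ} {L M : ℝ} (hT : 0 < T) (hL : 0 ≤ L) (hM : 0 < M) (hn : (Fintype.card α : ℝ) ≤ M)
    (hgap : ∀ A ∈ 𝓕, ∀ B ∈ 𝓕, A ⊆ B → B.card ≤ A.card + T → B.card ≤ A.card + k) :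
    (𝓕.card : ℝ) ≤ 2 ^ Fintype.card α *
      (((⌈L⌉₊ / T + 1) * (k + 1) : ℕ) / √(Fintype.card α + 1) +
        2 * Real.exp (-(L ^ 2 / (2 * M)))) := by
  set n := Fintype.card α with hn_def
  have hup := (card_upper_tail_le (α := α) (L := L) hM hn 1 (Or.inl rfl)).resolve_right
    (not_lt.2 hL)
  have hdn := (card_upper_tail_le (α := α) (L := L) hM hn (-1) (Or.inr rfl)).resolve_right
    (not_lt.2 hL)
  rw [← hn_def] at hup hdn
  set U : Finset (Finset α) := {A : Finset α | L < 1 * (2 * A.card - n)}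
  set D : Finset (Finset α) := {A : Finset α | L < -1 * (2 * A.card - n)}
  set 𝓜 := {A ∈ 𝓕 | |2 * (A.card : ℝ) - n| ≤ L} with h𝓜
  have hcover : 𝓕 ⊆ 𝓜 ∪ (U ∪ D) := by
    intro A hA
    simp only [h𝓜, U, D, Finset.mem_union, Finset.mem_filter, Finset.mem_univ, true_and, hA]
    by_cases h : |2 * (A.card : ℝ) - n| ≤ L
    · exact Or.inl h
    · right
      rw [not_le, lt_abs] at h
      rcases h with h | h
      · left; linarith
      · right; linarith
  have hcard : (𝓕.card : ℝ) ≤ 𝓜.card + (U.card + D.card) := by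
    have := (Finset.card_le_card hcover).trans ((Finset.card_union_le _ _).trans
      (Nat.add_le_add_left (Finset.card_union_le U D) _))
    exact_mod_cast this
  have hmid : 𝓜.card ≤ n.choose (n / 2) * ((⌈L⌉₊ / T + 1) * (k + 1)) := by
    refine card_le_of_short_chains 𝓜 (lo := ⌈((n : ℝ) - L) / 2⌉₊) hT ?_ ?_
    · intro A hA
      have h := (Finset.mem_filter.1 hA).2
      rw [abs_le] at h
      refine ⟨Nat.ceil_le.2 (by linarith), ?_⟩
      have h1 := Nat.le_ceil (((n : ℝ) - L) / 2)
      have h2 := Nat.le_ceil L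
      have : (A.card : ℝ) ≤ ((⌈((n : ℝ) - L) / 2⌉₊ + ⌈L⌉₊ : ℕ) : ℝ) := by
        push_cast; linarith
      exact_mod_cast this
    · exact fun A hA B hB => hgap A (Finset.mem_filter.1 hA).1 B (Finset.mem_filter.1 hB).1
  have hmid' : (𝓜.card : ℝ) ≤ 2 ^ n / √(n + 1) * ((⌈L⌉₊ / T + 1) * (k + 1) : ℕ) := by
    have h1 : (𝓜.card : ℝ) ≤ n.choose (n / 2) * ((⌈L⌉₊ / T + 1) * (k + 1) : ℕ) := by
      exact_mod_cast hmid
    exact h1.trans (by gcongr; exact choose_half_le n)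
  calc (𝓕.card : ℝ) ≤ _ := hcard
    _ ≤ 2 ^ n / √(n + 1) * ((⌈L⌉₊ / T + 1) * (k + 1) : ℕ) +
        (2 ^ n * Real.exp (-(L ^ 2 / (2 * M))) + 2 ^ n * Real.exp (-(L ^ 2 / (2 * M)))) := by
      gcongr
    _ = _ := by ring

/-- The version of `card_short_chains_le` in which only the elements of `Z` may vary. -/
lemma card_short_chains_relative_le {m : ℕ} {Z : Finset ℕ} (hZ : Z ⊆ Finset.range m)
    (𝓖 : Finset (Finset ℕ)) (h𝓖 : ∀ S ∈ 𝓖, S ⊆ Finset.range m)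
    {T k : ℕ} {L M : ℝ} (hT : 0 < T) (hL : 0 ≤ L) (hM : 0 < M) (hm : (m : ℝ) ≤ M)
    (hgap : ∀ S ∈ 𝓖, ∀ S' ∈ 𝓖, S ⊆ S' → S' \ S ⊆ Z → (S' \ S).card ≤ T →
      (S' \ S).card ≤ k) :
    (𝓖.card : ℝ) ≤ 2 ^ m *
      (((⌈L⌉₊ / T + 1) * (k + 1) : ℕ) / √(Z.card + 1) + 2 * Real.exp (-(L ^ 2 / (2 * M)))) := by
  have hzm : Z.card ≤ m := by simpa using Finset.card_le_card hZ
  have hfib : ∀ D ∈ (Finset.range m \ Z).powerset,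
      ((({S ∈ 𝓖 | S \ Z = D} : Finset (Finset ℕ)).card : ℝ)) ≤ 2 ^ Z.card *
      (((⌈L⌉₊ / T + 1) * (k + 1) : ℕ) / √(Z.card + 1) + 2 * Real.exp (-(L ^ 2 / (2 * M)))) := by
    intro D _
    set 𝓓 : Finset (Finset ℕ) := {S ∈ 𝓖 | S \ Z = D} with h𝓓
    set f : Finset ℕ → Finset {x // x ∈ Z} := fun S => S.subtype (· ∈ Z) with hf
    have hsub : ∀ S ∈ 𝓓, ∀ S' ∈ 𝓓, f S ⊆ f S' → S ⊆ S' ∧ S' \ S ⊆ Z := by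
      intro S hS S' hS' h
      have e1 := (Finset.mem_filter.1 hS).2
      have e2 := (Finset.mem_filter.1 hS').2
      constructor
      · intro x hx
        by_cases hxZ : x ∈ Z
        · have : (⟨x, hxZ⟩ : {x // x ∈ Z}) ∈ f S := by simpa [hf] using hx
          simpa [hf] using h this
        · have : x ∈ S \ Z := Finset.mem_sdiff.2 ⟨hx, hxZ⟩
          rw [e1, ← e2] at this
          exact (Finset.mem_sdiff.1 this).1
      · intro x hx
        rw [Finset.mem_sdiff] at hx
        by_contra hxZ
        have : x ∈ S' \ Z := Finset.mem_sdiff.2 ⟨hx.1, hxZ⟩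
        rw [e2, ← e1] at this
        exact hx.2 (Finset.mem_sdiff.1 this).1
    have hinj : Set.InjOn f 𝓓 := by
      intro S hS S' hS' h
      exact (hsub S hS S' hS' h.le).1.antisymm (hsub S' hS' S hS h.ge).1
    have hcardf : ∀ S ∈ 𝓓, (f S).card + D.card = S.card := by
      intro S hS
      have e1 := (Finset.mem_filter.1 hS).2
      rw [hf, Finset.card_subtype, ← e1]
      have : Finset.filter (· ∈ Z) S = S ∩ Z := by
        ext; simp
      rw [this, Finset.card_inter_add_card_sdiff]
    rw [← Finset.card_image_of_injOn hinj]
    have key := card_short_chains_le (α := {x // x ∈ Z}) (𝓓.image f) (T := T) (k := k)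
      (L := L) (M := M) hT hL hM (by
        rw [Fintype.card_coe]
        exact le_trans (by exact_mod_cast hzm) hm) (by
        intro A hA B hB hAB hc
        obtain ⟨S, hS, rfl⟩ := Finset.mem_image.1 hA
        obtain ⟨S', hS', rfl⟩ := Finset.mem_image.1 hB
        obtain ⟨h1, h2⟩ := hsub S hS S' hS' hAB
        have c1 := hcardf S hS
        have c2 := hcardf S' hS'
        have c3 := Finset.card_sdiff_add_card_eq_card h1
        have := hgap S (Finset.mem_filter.1 hS).1 S' (Finset.mem_filter.1 hS').1 h1 h2
          (by omega)
        omega)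
    rw [Fintype.card_coe] at key
    exact key
  have hmaps : ∀ S ∈ 𝓖, S \ Z ∈ (Finset.range m \ Z).powerset := fun S hS =>
    Finset.mem_powerset.2 (Finset.sdiff_subset_sdiff (h𝓖 S hS) le_rfl)
  rw [Finset.card_eq_sum_card_fiberwise hmaps]
  push_cast
  refine (Finset.sum_le_sum hfib).trans (le_of_eq ?_)
  rw [Finset.sum_const, Finset.card_powerset, Finset.card_sdiff_of_subset hZ, Finset.card_range,
    nsmul_eq_mul, ← mul_assoc]
  push_cast
  rw [← pow_add, Nat.sub_add_cancel hzm]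

lemma sum_inv_sqrt_card_le (m : ℕ) :
    ∑ Z ∈ (Finset.range m).powerset, 1 / √((Z.card : ℝ) + 1) ≤ 2 ^ m * (2 / √(m + 1)) := by
  have h1 : ∑ Z ∈ (Finset.range m).powerset, 1 / ((Z.card : ℝ) + 1) ≤
      2 ^ m * (2 / (m + 1)) := by
    rw [Finset.sum_powerset_apply_card (fun z : ℕ => 1 / ((z : ℝ) + 1)), Finset.card_range]
    have h2 : ∀ z ∈ Finset.range (m + 1), m.choose z • (1 / ((z : ℝ) + 1)) =
        ((m + 1).choose (z + 1) : ℝ) / (m + 1) := by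
      intro z _
      have := Nat.add_one_mul_choose_eq m z
      have h3 : ((m : ℝ) + 1) * m.choose z = (m + 1).choose (z + 1) * (z + 1) := by
        exact_mod_cast this
      rw [nsmul_eq_mul]
      field_simp
      linarith
    rw [Finset.sum_congr rfl h2, ← Finset.sum_div, mul_div_assoc']
    have h4 : ∑ z ∈ Finset.range (m + 1), ((m + 1).choose (z + 1) : ℝ) ≤ 2 ^ (m + 1) := by
      have h5 := Nat.sum_range_choose (m + 1)
      rw [Finset.sum_range_succ'] at h5
      have : ∑ z ∈ Finset.range (m + 1), (m + 1).choose (z + 1) ≤ 2 ^ (m + 1) := by omega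
      exact_mod_cast this
    rw [pow_succ] at h4
    gcongr
  have hs : 0 < √((m : ℝ) + 1) := by positivity
  have hs2 : √((m : ℝ) + 1) ^ 2 = m + 1 := Real.sq_sqrt (by positivity)
  have h6 : ∀ Z ∈ (Finset.range m).powerset, 1 / √((Z.card : ℝ) + 1) ≤
      √((m : ℝ) + 1) / 2 * (1 / ((Z.card : ℝ) + 1)) + 1 / (2 * √((m : ℝ) + 1)) := by
    intro Z _
    have hz : 0 < √((Z.card : ℝ) + 1) := by positivity
    have hz2 : √((Z.card : ℝ) + 1) ^ 2 = Z.card + 1 := Real.sq_sqrt (by positivity)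
    have hz3 : 1 / ((Z.card : ℝ) + 1) = 1 / √((Z.card : ℝ) + 1) ^ 2 := by rw [hz2]
    rw [hz3]
    have : √((m : ℝ) + 1) / 2 * (1 / √((Z.card : ℝ) + 1) ^ 2) + 1 / (2 * √((m : ℝ) + 1)) -
        1 / √((Z.card : ℝ) + 1) = (√((m : ℝ) + 1) - √((Z.card : ℝ) + 1)) ^ 2 /
        (2 * √((m : ℝ) + 1) * √((Z.card : ℝ) + 1) ^ 2) := by
      field_simp
      ring
    have h0 : 0 ≤ (√((m : ℝ) + 1) - √((Z.card : ℝ) + 1)) ^ 2 /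
        (2 * √((m : ℝ) + 1) * √((Z.card : ℝ) + 1) ^ 2) := by positivity
    linarith
  refine (Finset.sum_le_sum h6).trans ?_
  rw [Finset.sum_add_distrib, ← Finset.mul_sum, Finset.sum_const, Finset.card_powerset,
    Finset.card_range, nsmul_eq_mul]
  push_cast
  calc √((m : ℝ) + 1) / 2 * ∑ Z ∈ (Finset.range m).powerset, 1 / ((Z.card : ℝ) + 1) +
        2 ^ m * (1 / (2 * √((m : ℝ) + 1)))
      ≤ √((m : ℝ) + 1) / 2 * (2 ^ m * (2 / √((m : ℝ) + 1) ^ 2)) +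
        2 ^ m * (1 / (2 * √((m : ℝ) + 1))) := by
        rw [hs2]; gcongr
    _ = 2 ^ m * (3 / 2 / √((m : ℝ) + 1)) := by field_simp; ring
    _ ≤ _ := by gcongr; norm_num

end Combinatorics

section Moments

/-- The `±1`-valued potential encoded by a point of the cube, extended by zero. -/
def pot {N : ℕ} (σ : Fin N → Bool) (n : ℕ) : ℝ := if h : n < N then bval (σ ⟨n, h⟩) else 0

/-- The quadratic form preserved by the unperturbed one-step map. -/
def energy (E : ℝ) (v : ℝ × ℝ) : ℝ := v.1 ^ 2 - E * (v.1 * v.2) + v.2 ^ 2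

lemma normSq_le_energy {δ E : ℝ} (hE : |E| ≤ 2 - δ) (v : ℝ × ℝ) :
    δ / 2 * (v.1 ^ 2 + v.2 ^ 2) ≤ energy E v := by
  have h1 : E * (v.1 * v.2) ≤ |E| * |v.1 * v.2| := (le_abs_self _).trans (abs_mul _ _).le
  have h2 : |v.1 * v.2| ≤ (v.1 ^ 2 + v.2 ^ 2) / 2 := by
    rw [abs_le]; constructor <;> nlinarith [sq_nonneg (v.1 + v.2), sq_nonneg (v.1 - v.2)]
  have h3 : |E| * |v.1 * v.2| ≤ (2 - δ) * ((v.1 ^ 2 + v.2 ^ 2) / 2) :=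
    mul_le_mul hE h2 (abs_nonneg _) ((abs_nonneg _).trans hE)
  unfold energy
  linarith

lemma pow_add_pow_le_of_perturbation {F A B c lam : ℝ} (hF : 0 < F) (hA : |A| ≤ c * F)
    (hB : B ≤ c * F) (h1 : 0 ≤ F - lam * A + lam ^ 2 * B) (h2 : 0 ≤ F + lam * A + lam ^ 2 * B)
    (q : ℕ) :
    (F - lam * A + lam ^ 2 * B) ^ q + (F + lam * A + lam ^ 2 * B) ^ q ≤
      2 * (Real.exp (q * lam ^ 2 * c + (q * lam * c) ^ 2 / 2) * F ^ q) := by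
  have hA' : lam * A = lam * (A / F) * F := by field_simp
  have hB' : lam ^ 2 * B ≤ lam ^ 2 * c * F := by
    rw [mul_assoc]; gcongr
  have key : ∀ s : ℝ, ∀ X : ℝ, 0 ≤ X → X = F + s + lam ^ 2 * B →
      X ^ q ≤ (Real.exp (q * lam ^ 2 * c) * F ^ q) * Real.exp (q * (s / F)) := by
    intro s X hX0 hX
    have : X ≤ F * Real.exp (s / F + lam ^ 2 * c) := by
      have := Real.add_one_le_exp (s / F + lam ^ 2 * c)
      have h3 : F * (s / F + lam ^ 2 * c + 1) ≤ F * Real.exp (s / F + lam ^ 2 * c) := by gcongr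
      have h4 : F * (s / F + lam ^ 2 * c + 1) = F + s + lam ^ 2 * c * F := by field_simp; ring
      linarith
    calc X ^ q ≤ (F * Real.exp (s / F + lam ^ 2 * c)) ^ q := by gcongr
      _ = _ := by
        rw [mul_pow, ← Real.exp_nat_mul, mul_add, Real.exp_add, mul_assoc (q : ℝ)]; ring
  have k1 := key (-(lam * A)) _ h1 (by ring)
  have k2 := key (lam * A) _ h2 (by ring)
  have hcosh : Real.exp (q * (lam * A / F)) + Real.exp (q * (-(lam * A) / F)) ≤
      2 * Real.exp ((q * lam * c) ^ 2 / 2) := by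
    have h := Real.cosh_le_exp_half_sq (q * (lam * A / F))
    rw [Real.cosh_eq] at h
    have h5 : (q * (lam * A / F)) ^ 2 ≤ (q * lam * c) ^ 2 := by
      have : |A / F| ≤ |c| := by
        rw [abs_div, abs_of_pos hF, div_le_iff₀ hF]
        exact hA.trans (by gcongr; exact le_abs_self c)
      have h6 : (A / F) ^ 2 ≤ c ^ 2 := sq_le_sq.2 this
      calc (q * (lam * A / F)) ^ 2 = (q * lam) ^ 2 * (A / F) ^ 2 := by ring
        _ ≤ (q * lam) ^ 2 * c ^ 2 := by gcongr
        _ = _ := by ring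
    have h7 : Real.exp ((q * (lam * A / F)) ^ 2 / 2) ≤ Real.exp ((q * lam * c) ^ 2 / 2) := by
      gcongr
    have : q * (-(lam * A) / F) = -(q * (lam * A / F)) := by ring
    rw [this]
    linarith
  calc _ ≤ (Real.exp (q * lam ^ 2 * c) * F ^ q) * (Real.exp (q * (lam * A / F)) +
        Real.exp (q * (-(lam * A) / F))) := by rw [mul_add]; linarith
    _ ≤ (Real.exp (q * lam ^ 2 * c) * F ^ q) * (2 * Real.exp ((q * lam * c) ^ 2 / 2)) := by
      gcongr
    _ = _ := by rw [Real.exp_add]; ring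

/-- The total energy of a fundamental system. -/
def sysEnergy (lam E : ℝ) (ε : ℕ → ℝ) (n : ℕ) : ℝ :=
  energy E (orb lam E ε (1, 0) n) + energy E (orb lam E ε (0, 1) n)

lemma hsq_le_sysEnergy {δ E lam : ℝ} (hE : |E| ≤ 2 - δ) (ε : ℕ → ℝ) (n : ℕ) :
    δ / 2 * hsq lam E ε n ≤ sysEnergy lam E ε n := by
  have h1 := normSq_le_energy hE (orb lam E ε (1, 0) n)
  have h2 := normSq_le_energy hE (orb lam E ε (0, 1) n)
  unfold sysEnergy hsq
  linarith

lemma energy_step {δ E : ℝ} (hδ : 0 < δ) (hE : |E| ≤ 2 - δ) (v : ℝ × ℝ) :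
    |v.1 * (E * v.1 - 2 * v.2)| ≤ 6 / δ * energy E v ∧ v.1 ^ 2 ≤ 6 / δ * energy E v := by
  have h := normSq_le_energy hE v
  have hn : v.1 ^ 2 + v.2 ^ 2 ≤ 2 / δ * energy E v := by
    rw [div_mul_eq_mul_div, le_div_iff₀ hδ]; linarith
  have h6 : 6 / δ * energy E v = 3 * (2 / δ * energy E v) := by ring
  have hE1 := abs_le.1 (hE.trans (by linarith : 2 - δ ≤ 2))
  rw [h6]
  constructor
  · refine le_trans ?_ (mul_le_mul_of_nonneg_left hn (by norm_num))
    rw [abs_le]; constructor <;>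
      nlinarith [sq_nonneg (v.1 + v.2), sq_nonneg (v.1 - v.2), sq_nonneg v.1,
        mul_nonneg (sq_nonneg v.1) (by linarith [hE1.1] : 0 ≤ 2 + E),
        mul_nonneg (sq_nonneg v.1) (by linarith [hE1.2] : 0 ≤ 2 - E)]
  · nlinarith [sq_nonneg v.1, sq_nonneg v.2]

lemma sysEnergy_pow_pair_le {δ E lam : ℝ} (hδ : 0 < δ) (hE : |E| ≤ 2 - δ)
    {ε ε' : ℕ → ℝ} {n : ℕ} (h : ∀ j < n, ε j = ε' j) (h1 : ε n = 1) (h2 : ε' n = -1) (q : ℕ) :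
    sysEnergy lam E ε (n + 1) ^ q + sysEnergy lam E ε' (n + 1) ^ q ≤
      Real.exp (q * lam ^ 2 * (6 / δ) + (q * lam * (6 / δ)) ^ 2 / 2) *
        (sysEnergy lam E ε n ^ q + sysEnergy lam E ε' n ^ q) := by
  have hpos : ∀ (η : ℕ → ℝ) k, 0 < sysEnergy lam E η k := fun η k =>
    lt_of_lt_of_le (by have := one_le_hsq (lam := lam) (E := E) (ε := η) k; positivity)
      (hsq_le_sysEnergy hE η k)
  have e1 : sysEnergy lam E ε' n = sysEnergy lam E ε n := by
    simp only [sysEnergy, orb_congr h le_rfl]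
  have oa := orb_congr (lam := lam) (E := E) (p := (1, 0)) h le_rfl
  have ob := orb_congr (lam := lam) (E := E) (p := (0, 1)) h le_rfl
  have sa := energy_step hδ hE (orb lam E ε (1, 0) n)
  have sb := energy_step hδ hE (orb lam E ε (0, 1) n)
  have hF := hpos ε n
  have p1 := hpos ε (n + 1)
  have p2 := hpos ε' (n + 1)
  have f1 : sysEnergy lam E ε (n + 1) = sysEnergy lam E ε n -
      lam * ((orb lam E ε (1, 0) n).1 * (E * (orb lam E ε (1, 0) n).1 -
          2 * (orb lam E ε (1, 0) n).2) +
        (orb lam E ε (0, 1) n).1 * (E * (orb lam E ε (0, 1) n).1 - 2 * (orb lam E ε (0, 1) n).2)) +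
      lam ^ 2 * ((orb lam E ε (1, 0) n).1 ^ 2 + (orb lam E ε (0, 1) n).1 ^ 2) := by
    simp only [sysEnergy, energy, orb, h1]; ring
  have f2 : sysEnergy lam E ε' (n + 1) = sysEnergy lam E ε n +
      lam * ((orb lam E ε (1, 0) n).1 * (E * (orb lam E ε (1, 0) n).1 -
          2 * (orb lam E ε (1, 0) n).2) +
        (orb lam E ε (0, 1) n).1 * (E * (orb lam E ε (0, 1) n).1 - 2 * (orb lam E ε (0, 1) n).2)) +
      lam ^ 2 * ((orb lam E ε (1, 0) n).1 ^ 2 + (orb lam E ε (0, 1) n).1 ^ 2) := by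
    simp only [sysEnergy, energy, orb, h2, ← oa, ← ob]; ring
  rw [f1] at p1
  rw [f2] at p2
  rw [f1, f2, e1]
  refine (pow_add_pow_le_of_perturbation (c := 6 / δ) hF ?_ ?_ p1.le p2.le q).trans
    (le_of_eq (by ring))
  · refine (abs_add_le _ _).trans ?_
    unfold sysEnergy
    linarith [sa.1, sb.1]
  · unfold sysEnergy
    linarith [sa.2, sb.2]

lemma sum_sysEnergy_pow_succ_le {δ E lam : ℝ} (hδ : 0 < δ) (hE : |E| ≤ 2 - δ)
    {N n : ℕ} (hn : n < N) (q : ℕ) :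
    ∑ σ : Fin N → Bool, sysEnergy lam E (pot σ) (n + 1) ^ q ≤
      Real.exp (q * lam ^ 2 * (6 / δ) + (q * lam * (6 / δ)) ^ 2 / 2) *
        ∑ σ : Fin N → Bool, sysEnergy lam E (pot σ) n ^ q := by
  set i : Fin N := ⟨n, hn⟩ with hi
  have hinv : Function.Involutive fun σ : Fin N → Bool => Function.update σ i (!σ i) := by
    intro σ; simp
  have hsum : ∀ G : (Fin N → Bool) → ℝ, ∑ σ, G (Function.update σ i (!σ i)) = ∑ σ, G σ :=
    fun G => hinv.bijective.sum_comp G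
  have hj : ∀ (σ : Fin N → Bool), ∀ j < n, pot σ j = pot (Function.update σ i (!σ i)) j := by
    intro σ j hj
    have hjN : j < N := hj.trans hn
    have : (⟨j, hjN⟩ : Fin N) ≠ i := by
      intro h; rw [hi, Fin.mk.injEq] at h; omega
    simp [pot, hjN, Function.update_of_ne this]
  have hi1 : ∀ (σ : Fin N → Bool), pot σ n = bval (σ i) := fun σ => by simp [pot, hn, hi]
  have hi2 : ∀ (σ : Fin N → Bool), pot (Function.update σ i (!σ i)) n = bval (!σ i) :=
    fun σ => by rw [hi1]; simp
  have hpair : ∀ σ : Fin N → Bool, sysEnergy lam E (pot σ) (n + 1) ^ q +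
      sysEnergy lam E (pot (Function.update σ i (!σ i))) (n + 1) ^ q ≤
      Real.exp (q * lam ^ 2 * (6 / δ) + (q * lam * (6 / δ)) ^ 2 / 2) *
        (sysEnergy lam E (pot σ) n ^ q +
          sysEnergy lam E (pot (Function.update σ i (!σ i))) n ^ q) := by
    intro σ
    cases hσ : σ i
    · rw [add_comm (sysEnergy lam E (pot σ) (n + 1) ^ q), add_comm (sysEnergy lam E (pot σ) n ^ q)]
      refine sysEnergy_pow_pair_le hδ hE (fun j h => ?_) ?_ ?_ q
      · rw [hj σ j h, hσ]
      · have := hi2 σ; rw [hσ] at this; rw [this]; simp [bval]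
      · rw [hi1, hσ]; simp [bval]
    · refine sysEnergy_pow_pair_le hδ hE (fun j h => ?_) ?_ ?_ q
      · rw [hj σ j h, hσ]
      · rw [hi1, hσ]; simp [bval]
      · have := hi2 σ; rw [hσ] at this; rw [this]; simp [bval]
  have h := Finset.sum_le_sum fun σ (_ : σ ∈ Finset.univ) => hpair σ
  rw [Finset.sum_add_distrib, ← Finset.mul_sum, Finset.sum_add_distrib,
    hsum fun σ => sysEnergy lam E (pot σ) (n + 1) ^ q,
    hsum fun σ => sysEnergy lam E (pot σ) n ^ q] at h
  linarith

/-- The exponent in the moment bound for transfer matrices. -/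
def momentExp (δ : ℝ) : ℝ := 4 / δ + 2 * (6 / δ + (6 / δ) ^ 2)

lemma sum_hsq_pow_le {δ E lam : ℝ} (hδ : 0 < δ) (hE : |E| ≤ 2 - δ)
    {N n q : ℕ} (hn : n ≤ N) (hN : N * lam ^ 2 ≤ 2) (hq : 1 ≤ q) :
    ∑ σ : Fin N → Bool, hsq lam E (pot σ) n ^ q ≤ 2 ^ N * Real.exp (momentExp δ * q ^ 2) := by
  set c := q * lam ^ 2 * (6 / δ) + (q * lam * (6 / δ)) ^ 2 / 2 with hc
  have hF : ∀ k ≤ N, ∑ σ : Fin N → Bool, sysEnergy lam E (pot σ) k ^ q ≤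
      Real.exp (k * c) * (2 ^ N * 2 ^ q) := by
    intro k hk
    induction k with
    | zero =>
      simp [sysEnergy, energy, orb]
      norm_num
    | succ k ih =>
      refine (sum_sysEnergy_pow_succ_le hδ hE (by omega) q).trans ?_
      rw [← hc]
      push_cast
      rw [show ((k : ℝ) + 1) * c = c + k * c by ring, Real.exp_add c, mul_assoc]
      exact mul_le_mul_of_nonneg_left (ih (by omega)) (Real.exp_pos _).le
  have hq1 : (1 : ℝ) ≤ q := by exact_mod_cast hq
  have h1 : ∀ σ : Fin N → Bool, hsq lam E (pot σ) n ^ q ≤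
      (2 / δ) ^ q * sysEnergy lam E (pot σ) n ^ q := by
    intro σ
    have := hsq_le_sysEnergy (lam := lam) hE (pot σ) n
    have h0 := one_le_hsq (lam := lam) (E := E) (ε := pot σ) n
    rw [← mul_pow]
    gcongr
    rw [div_mul_eq_mul_div, le_div_iff₀ hδ]
    linarith
  have hcn : n * c ≤ 2 * (6 / δ + (6 / δ) ^ 2) * q ^ 2 := by
    have hnN : (n : ℝ) ≤ N := by exact_mod_cast hn
    have hn2 : n * lam ^ 2 ≤ 2 := le_trans (by gcongr) hN
    calc n * c = (n * lam ^ 2) * (q * (6 / δ) + q ^ 2 * (6 / δ) ^ 2 / 2) := by rw [hc]; ring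
      _ ≤ 2 * (q ^ 2 * (6 / δ) + q ^ 2 * (6 / δ) ^ 2) := by
        gcongr
        · nlinarith
        · have : 0 ≤ (q : ℝ) ^ 2 * (6 / δ) ^ 2 := by positivity
          linarith
      _ = _ := by ring
  have h4 : (4 / δ) ^ q ≤ Real.exp (4 / δ * q ^ 2) := by
    calc (4 / δ) ^ q ≤ (Real.exp (4 / δ)) ^ q := by
          gcongr
          linarith [Real.add_one_le_exp (4 / δ)]
      _ = Real.exp (q * (4 / δ)) := (Real.exp_nat_mul _ _).symm
      _ ≤ _ := by
          have : (q : ℝ) ≤ q ^ 2 := by nlinarith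
          rw [mul_comm]
          gcongr
  calc ∑ σ : Fin N → Bool, hsq lam E (pot σ) n ^ q
      ≤ (2 / δ) ^ q * ∑ σ : Fin N → Bool, sysEnergy lam E (pot σ) n ^ q := by
        rw [Finset.mul_sum]; exact Finset.sum_le_sum fun σ _ => h1 σ
    _ ≤ (2 / δ) ^ q * (Real.exp (n * c) * (2 ^ N * 2 ^ q)) := by gcongr; exact hF n hn
    _ = 2 ^ N * ((4 / δ) ^ q * Real.exp (n * c)) := by
        rw [show 4 / δ = 2 / δ * 2 by ring, mul_pow]; ring
    _ ≤ 2 ^ N * (Real.exp (4 / δ * q ^ 2) *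
        Real.exp (2 * (6 / δ + (6 / δ) ^ 2) * q ^ 2)) := by gcongr
    _ = _ := by rw [← Real.exp_add, momentExp, add_mul]

lemma sum_hsq_of_large_le {δ E lam K : ℝ} (hδ : 0 < δ) (hE : |E| ≤ 2 - δ)
    {N q : ℕ} (hN : N * lam ^ 2 ≤ 2) (hK : 0 ≤ K) (s : Finset (Fin N → Bool))
    (hs : ∀ σ ∈ s, ∃ n ≤ N, K < hsq lam E (pot σ) n) :
    (∑ σ ∈ s, hsq lam E (pot σ) N) * K ^ q ≤
      (N + 1) * (2 ^ N * Real.exp (momentExp δ * (q + 1 : ℕ) ^ 2)) := by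
  have h0 : ∀ (σ : Fin N → Bool) n, 0 ≤ hsq lam E (pot σ) n := fun σ n =>
    zero_le_one.trans (one_le_hsq n)
  have h1 : ∀ σ ∈ s, hsq lam E (pot σ) N * K ^ q ≤
      ∑ n ∈ Finset.range (N + 1), hsq lam E (pot σ) n ^ (q + 1) := by
    intro σ hσ
    have hsing : ∀ n ≤ N, hsq lam E (pot σ) n ^ (q + 1) ≤
        ∑ n ∈ Finset.range (N + 1), hsq lam E (pot σ) n ^ (q + 1) := fun n hn =>
      Finset.single_le_sum (f := fun n => hsq lam E (pot σ) n ^ (q + 1))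
        (fun k _ => pow_nonneg (h0 σ k) _) (Finset.mem_range.2 (by omega))
    by_cases hb : K ≤ hsq lam E (pot σ) N
    · refine le_trans ?_ (hsing N le_rfl)
      rw [pow_succ, mul_comm]
      have := h0 σ N
      gcongr
    · obtain ⟨n, hn, hKn⟩ := hs σ hσ
      refine le_trans ?_ (hsing n hn)
      rw [pow_succ, mul_comm]
      push Not at hb
      have := h0 σ N
      have := h0 σ n
      gcongr
      linarith
  calc (∑ σ ∈ s, hsq lam E (pot σ) N) * K ^ q
      ≤ ∑ σ ∈ s, ∑ n ∈ Finset.range (N + 1), hsq lam E (pot σ) n ^ (q + 1) := by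
        rw [Finset.sum_mul]; exact Finset.sum_le_sum h1
    _ ≤ ∑ σ : Fin N → Bool, ∑ n ∈ Finset.range (N + 1), hsq lam E (pot σ) n ^ (q + 1) :=
        Finset.sum_le_sum_of_subset_of_nonneg (Finset.subset_univ _) fun σ _ _ =>
          Finset.sum_nonneg fun n _ => pow_nonneg (h0 σ n) _
    _ = ∑ n ∈ Finset.range (N + 1), ∑ σ : Fin N → Bool, hsq lam E (pot σ) n ^ (q + 1) :=
        Finset.sum_comm
    _ ≤ ∑ n ∈ Finset.range (N + 1), 2 ^ N * Real.exp (momentExp δ * (q + 1 : ℕ) ^ 2) :=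
        Finset.sum_le_sum fun n hn => sum_hsq_pow_le hδ hE
          (by have := Finset.mem_range.1 hn; omega) hN (by omega)
    _ = _ := by simp

end Moments

section Anticoncentration

/-- The Wronskian of two orbits with the same initial point. -/
lemma wronskian_eq_sum {lam E : ℝ} {ε ε' : ℕ → ℝ} (p : ℝ × ℝ) (N : ℕ) :
    (orb lam E ε p N).1 * (orb lam E ε' p N).2 - (orb lam E ε p N).2 * (orb lam E ε' p N).1 =
      ∑ n ∈ Finset.range N,
        lam * (ε' n - ε n) * ((orb lam E ε p n).1 * (orb lam E ε' p n).1) := by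
  induction N with
  | zero => simp [orb]; ring
  | succ N ih => rw [wronskian_succ, ih, Finset.sum_range_succ]

lemma sum_range_ite_half_mem {N : ℕ} {A : Finset ℕ} (hA : A ⊆ Finset.range (N / 2))
    (f : ℕ → ℝ) :
    ∑ n ∈ Finset.range N, (if n / 2 ∈ A then f n else 0) =
      ∑ k ∈ A, (f (2 * k) + f (2 * k + 1)) := by
  have h2 : ∀ m, ∑ n ∈ Finset.range (2 * m), (if n / 2 ∈ A then f n else 0) =
      ∑ k ∈ Finset.range m, if k ∈ A then f (2 * k) + f (2 * k + 1) else 0 := by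
    intro m
    induction m with
    | zero => simp
    | succ m ih =>
      rw [show 2 * (m + 1) = 2 * m + 1 + 1 by ring, Finset.sum_range_succ, Finset.sum_range_succ,
        ih, Finset.sum_range_succ, show (2 * m + 1) / 2 = m by omega,
        show 2 * m / 2 = m by omega]
      split_ifs <;> ring
  have h3 : ∑ n ∈ Finset.range N, (if n / 2 ∈ A then f n else 0) =
      ∑ n ∈ Finset.range (2 * (N / 2)), (if n / 2 ∈ A then f n else 0) := by
    obtain ⟨m, rfl | rfl⟩ := N.even_or_odd'
    · rw [show 2 * m / 2 = m by omega]
    · have : m ∉ A := fun h => by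
        have := Finset.mem_range.1 (hA h)
        omega
      rw [show (2 * m + 1) / 2 = m by omega, Finset.sum_range_succ,
        show 2 * m / 2 = m by omega, if_neg this, add_zero]
  rw [h3, h2, Finset.sum_ite_mem, Finset.inter_eq_right.2 hA]

/-- A vector of the cube described by the set `S` of pairs of consecutive sites whose first sign is
positive, and the set `Z` of pairs whose two signs agree. -/
def cubePoint (N : ℕ) (ρ : Bool) (Z S : Finset ℕ) (j : Fin N) : Bool :=
  if (j : ℕ) / 2 < N / 2 then
    if (j : ℕ) % 2 = 0 then decide ((j : ℕ) / 2 ∈ S)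
    else decide ((j : ℕ) / 2 ∈ S ↔ (j : ℕ) / 2 ∈ Z)
  else ρ

lemma exists_cubePoint {N : ℕ} (σ : Fin N → Bool) :
    ∃ ρ, ∃ Z ∈ (Finset.range (N / 2)).powerset, ∃ S ∈ (Finset.range (N / 2)).powerset,
      cubePoint N ρ Z S = σ := by
  set s : ℕ → Bool := fun n => if h : n < N then σ ⟨n, h⟩ else false with hs
  have hsσ : ∀ j : Fin N, s j = σ j := fun j => by simp [hs]
  refine ⟨s (2 * (N / 2)), {k ∈ Finset.range (N / 2) | s (2 * k) = s (2 * k + 1)}, by simp,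
    {k ∈ Finset.range (N / 2) | s (2 * k) = true}, by simp, ?_⟩
  funext j
  have hj := j.2
  rw [← hsσ]
  unfold cubePoint
  split_ifs with h1 h2
  · simp only [Finset.mem_filter, Finset.mem_range, h1, true_and]
    rw [show 2 * ((j : ℕ) / 2) = j by omega]
    simp
  · simp only [Finset.mem_filter, Finset.mem_range, h1, true_and]
    rw [show 2 * ((j : ℕ) / 2) + 1 = j by omega]
    cases s (2 * ((j : ℕ) / 2)) <;> cases s j <;> simp
  · congr 1; omega

lemma card_le_sum_cubePoint {N : ℕ} (F : Finset (Fin N → Bool)) :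
    F.card ≤ ∑ ρ : Bool, ∑ Z ∈ (Finset.range (N / 2)).powerset,
      ({S ∈ (Finset.range (N / 2)).powerset | cubePoint N ρ Z S ∈ F}).card := by
  classical
  have : F ⊆ Finset.univ.biUnion fun ρ : Bool => (Finset.range (N / 2)).powerset.biUnion fun Z =>
      ({S ∈ (Finset.range (N / 2)).powerset | cubePoint N ρ Z S ∈ F}).image
        (cubePoint N ρ Z) := by
    intro σ hσ
    obtain ⟨ρ, Z, hZ, S, hS, rfl⟩ := exists_cubePoint σ
    simp only [Finset.mem_biUnion, Finset.mem_image, Finset.mem_filter]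
    exact ⟨ρ, Finset.mem_univ _, Z, hZ, S, ⟨hS, hσ⟩, rfl⟩
  refine (Finset.card_le_card this).trans (Finset.card_biUnion_le.trans ?_)
  refine Finset.sum_le_sum fun ρ _ => Finset.card_biUnion_le.trans ?_
  exact Finset.sum_le_sum fun Z _ => Finset.card_image_le

lemma pot_cubePoint_sub {N : ℕ} (ρ : Bool) {Z S S' : Finset ℕ} (hSS : S ⊆ S')
    (hZ : S' \ S ⊆ Z) (hS' : S' ⊆ Finset.range (N / 2)) {n : ℕ} (hn : n < N) :
    pot (cubePoint N ρ Z S') n - pot (cubePoint N ρ Z S) n =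
      if n / 2 ∈ S' \ S then 2 else 0 := by
  have hmem : n / 2 ∈ S' → n / 2 < N / 2 := fun h => Finset.mem_range.1 (hS' h)
  have hsub := @hSS (n / 2)
  have hz := @hZ (n / 2)
  simp only [Finset.mem_sdiff] at hz ⊢
  simp only [pot, hn, dif_pos, cubePoint, bval]
  by_cases h1 : n / 2 ∈ S' <;> by_cases h2 : n / 2 ∈ S <;> by_cases h3 : n / 2 ∈ Z <;>
    by_cases h4 : n / 2 < N / 2 <;> simp_all
  norm_num

lemma wronskian_le_of_projection {α x y x' y' u w r K δ : ℝ} (hu : u ^ 2 + w ^ 2 = 1)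
    (hr : 0 ≤ r) (hK : 1 ≤ K) (hδ : 0 ≤ δ) (hv : x ^ 2 + y ^ 2 ≤ K * r ^ 2)
    (hv' : x' ^ 2 + y' ^ 2 ≤ K * r ^ 2) (h : (u * x + w * y) ^ 2 ≤ δ ^ 2 * r ^ 2)
    (h' : (u * x' + w * y') ^ 2 ≤ δ ^ 2 * r ^ 2) (hα : α = x * y' - y * x') :
    α ≤ 2 * δ * K * r ^ 2 := by
  have a1 : |u * x + w * y| ≤ δ * r := abs_le_of_sq_le_sq (by rw [mul_pow]; exact h) (by positivity)
  have a2 : |u * x' + w * y'| ≤ δ * r :=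
    abs_le_of_sq_le_sq (by rw [mul_pow]; exact h') (by positivity)
  have key : ∀ a b : ℝ, a ^ 2 + b ^ 2 ≤ K * r ^ 2 → |u * b - w * a| ≤ K * r := by
    intro a b hab
    refine abs_le_of_sq_le_sq ?_ (by positivity)
    have e : (u * b - w * a) ^ 2 + (u * a + w * b) ^ 2 = a ^ 2 + b ^ 2 := by
      linear_combination (a ^ 2 + b ^ 2) * hu
    have : K * r ^ 2 ≤ K ^ 2 * r ^ 2 := by gcongr; nlinarith
    nlinarith [sq_nonneg (u * a + w * b)]
  have b1 := key x y hv
  have b2 := key x' y' hv'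
  have e : α = (u * x + w * y) * (u * y' - w * x') - (u * y - w * x) * (u * x' + w * y') := by
    rw [hα]; linear_combination -(x * y' - y * x') * hu
  rw [e]
  refine (le_abs_self _).trans ((abs_sub _ _).trans ?_)
  rw [abs_mul, abs_mul]
  calc _ ≤ (δ * r) * (K * r) + (K * r) * (δ * r) := by gcongr
    _ = _ := by ring

/-- Two configurations with small projection which differ on few pairs of sites differ on very few
pairs of sites. -/
lemma card_sdiff_le_of_projection {lam E K δ : ℝ} {u p : ℝ × ℝ} {N T k : ℕ}
    (hlam : 0 < lam) (hu : u.1 ^ 2 + u.2 ^ 2 = 1)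
    (hp : 0 < p.1 ^ 2 + p.2 ^ 2) (hδ : 0 ≤ δ) (hT : 48 * K ^ 2 * lam * T ≤ 1)
    (hk : 2 * δ * K ^ 2 < lam * (k + 1)) (ρ : Bool) {Z S S' : Finset ℕ} (hSS : S ⊆ S')
    (hZ : S' \ S ⊆ Z) (hS' : S' ⊆ Finset.range (N / 2)) (hc : (S' \ S).card ≤ T)
    (hg : ∀ n ≤ N, hsq lam E (pot (cubePoint N ρ Z S)) n ≤ K)
    (hg' : ∀ n ≤ N, hsq lam E (pot (cubePoint N ρ Z S')) n ≤ K)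
    (hpr : (u.1 * (orb lam E (pot (cubePoint N ρ Z S)) p N).1 +
      u.2 * (orb lam E (pot (cubePoint N ρ Z S)) p N).2) ^ 2 ≤ δ ^ 2 * (p.1 ^ 2 + p.2 ^ 2))
    (hpr' : (u.1 * (orb lam E (pot (cubePoint N ρ Z S')) p N).1 +
      u.2 * (orb lam E (pot (cubePoint N ρ Z S')) p N).2) ^ 2 ≤ δ ^ 2 * (p.1 ^ 2 + p.2 ^ 2)) :
    (S' \ S).card ≤ k := by
  set ε := pot (cubePoint N ρ Z S)
  set ε' := pot (cubePoint N ρ Z S')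
  have hK1 : 1 ≤ K := (one_le_hsq N).trans (hg N le_rfl)
  have hA : S' \ S ⊆ Finset.range (N / 2) := Finset.sdiff_subset.trans hS'
  have hdiff : ∀ n ∈ Finset.range N, ε' n - ε n = if n / 2 ∈ S' \ S then 2 else 0 :=
    fun n hn => pot_cubePoint_sub ρ hSS hZ hS' (Finset.mem_range.1 hn)
  have hsum : ∑ n ∈ Finset.range N, |ε' n - ε n| = 4 * ((S' \ S).card : ℝ) := by
    have : ∀ n ∈ Finset.range N, |ε' n - ε n| = if n / 2 ∈ S' \ S then (fun _ => 2) n else 0 := by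
      intro n hn
      rw [hdiff n hn]
      split_ifs <;> norm_num
    rw [Finset.sum_congr rfl this, sum_range_ite_half_mem hA]
    simp
    ring
  have hs : 12 * K ^ 2 * lam * ∑ j ∈ Finset.range N, |ε' j - ε j| ≤ 1 := by
    rw [hsum]
    refine le_trans ?_ hT
    have : ((S' \ S).card : ℝ) ≤ T := by exact_mod_cast hc
    calc _ = 48 * K ^ 2 * lam * ((S' \ S).card : ℝ) := by ring
      _ ≤ _ := by gcongr
  have hW := wronskian_eq_sum (lam := lam) (E := E) (ε := ε) (ε' := ε') p N
  have hW2 : ∑ n ∈ Finset.range N,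
        lam * (ε' n - ε n) * ((orb lam E ε p n).1 * (orb lam E ε' p n).1) =
      ∑ k ∈ S' \ S, 2 * lam * ((orb lam E ε p (2 * k + 1)).1 * (orb lam E ε' p (2 * k + 1)).1 +
        (orb lam E ε p (2 * k + 1)).2 * (orb lam E ε' p (2 * k + 1)).2) := by
    have : ∀ n ∈ Finset.range N,
        lam * (ε' n - ε n) * ((orb lam E ε p n).1 * (orb lam E ε' p n).1) =
        if n / 2 ∈ S' \ S then
          (fun n => 2 * lam * ((orb lam E ε p n).1 * (orb lam E ε' p n).1)) n else 0 := by
      intro n hn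
      rw [hdiff n hn]
      split_ifs <;> ring
    rw [Finset.sum_congr rfl this, sum_range_ite_half_mem hA]
    refine Finset.sum_congr rfl fun k _ => ?_
    simp only [orb]
    ring
  have hlow : lam * ((S' \ S).card : ℝ) * ((p.1 ^ 2 + p.2 ^ 2) / K) ≤
      (orb lam E ε p N).1 * (orb lam E ε' p N).2 - (orb lam E ε p N).2 * (orb lam E ε' p N).1 := by
    rw [hW, hW2]
    have : lam * ((S' \ S).card : ℝ) * ((p.1 ^ 2 + p.2 ^ 2) / K) =
        ∑ k ∈ S' \ S, 2 * lam * ((p.1 ^ 2 + p.2 ^ 2) / (2 * K)) := by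
      rw [Finset.sum_const, nsmul_eq_mul]
      field_simp
    rw [this]
    refine Finset.sum_le_sum fun k hk => ?_
    have := Finset.mem_range.1 (hA hk)
    gcongr
    exact half_normSq_le_inner hlam.le hg hs (by omega)
  have hr2 : √(p.1 ^ 2 + p.2 ^ 2) ^ 2 = p.1 ^ 2 + p.2 ^ 2 := Real.sq_sqrt hp.le
  have hbound : ∀ η : ℕ → ℝ, hsq lam E η N ≤ K →
      (orb lam E η p N).1 ^ 2 + (orb lam E η p N).2 ^ 2 ≤ K * (p.1 ^ 2 + p.2 ^ 2) := fun η h =>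
    (orb_normSq_le N).trans (mul_le_mul_of_nonneg_right h hp.le)
  have hup := wronskian_le_of_projection (r := √(p.1 ^ 2 + p.2 ^ 2))
    (x := (orb lam E ε p N).1) (y := (orb lam E ε p N).2) (x' := (orb lam E ε' p N).1)
    (y' := (orb lam E ε' p N).2) hu (Real.sqrt_nonneg _) hK1 hδ
    (by rw [hr2]; exact hbound ε (hg N le_rfl)) (by rw [hr2]; exact hbound ε' (hg' N le_rfl))
    (by rw [hr2]; exact hpr) (by rw [hr2]; exact hpr') rfl
  rw [hr2] at hup
  have h1 := hlow.trans hup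
  have h2 : lam * ((S' \ S).card : ℝ) ≤ 2 * δ * K ^ 2 := by
    rw [mul_div_assoc', div_le_iff₀ (by linarith)] at h1
    refine le_of_mul_le_mul_right (h1.trans (le_of_eq ?_)) hp
    ring
  have h3 : ((S' \ S).card : ℝ) < k + 1 := lt_of_mul_lt_mul_left (h2.trans_lt hk) hlam.le
  have h4 : (S' \ S).card < k + 1 := by exact_mod_cast h3
  omega

lemma card_small_projection_le {lam E K δ L M : ℝ} {u p : ℝ × ℝ} {N T k : ℕ}
    (hlam : 0 < lam) (hu : u.1 ^ 2 + u.2 ^ 2 = 1)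
    (hp : 0 < p.1 ^ 2 + p.2 ^ 2) (hδ : 0 ≤ δ) (hT0 : 0 < T) (hT : 48 * K ^ 2 * lam * T ≤ 1)
    (hk : 2 * δ * K ^ 2 < lam * (k + 1)) (hL : 0 ≤ L) (hM : 0 < M) (hm : ((N / 2 : ℕ) : ℝ) ≤ M)
    (F : Finset (Fin N → Bool)) (hg : ∀ σ ∈ F, ∀ n ≤ N, hsq lam E (pot σ) n ≤ K)
    (hpr : ∀ σ ∈ F, (u.1 * (orb lam E (pot σ) p N).1 + u.2 * (orb lam E (pot σ) p N).2) ^ 2 ≤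
      δ ^ 2 * (p.1 ^ 2 + p.2 ^ 2)) :
    (F.card : ℝ) ≤ 2 * 2 ^ N * (((⌈L⌉₊ / T + 1) * (k + 1) : ℕ) * (2 / √((N / 2 : ℕ) + 1)) +
      2 * Real.exp (-(L ^ 2 / (2 * M)))) := by
  set m := N / 2 with hm_def
  set R : ℝ := (((⌈L⌉₊ / T + 1) * (k + 1) : ℕ) : ℝ) with hR
  set t : ℝ := 2 * Real.exp (-(L ^ 2 / (2 * M))) with ht
  have hfib : ∀ ρ : Bool, ∀ Z ∈ (Finset.range m).powerset,
      ((({S ∈ (Finset.range m).powerset | cubePoint N ρ Z S ∈ F}).card : ℕ) : ℝ) ≤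
        2 ^ m * (R * (1 / √((Z.card : ℝ) + 1)) + t) := by
    intro ρ Z hZ
    have := card_short_chains_relative_le (T := T) (k := k) (L := L) (M := M)
      (Finset.mem_powerset.1 hZ) {S ∈ (Finset.range m).powerset | cubePoint N ρ Z S ∈ F}
      (fun S hS => Finset.mem_powerset.1 (Finset.mem_filter.1 hS).1) hT0 hL hM hm (by
        intro S hS S' hS' h1 h2 h3
        rw [Finset.mem_filter, Finset.mem_powerset] at hS hS'
        exact card_sdiff_le_of_projection hlam hu hp hδ hT hk ρ h1 h2 hS'.1 h3
          (hg _ hS.2) (hg _ hS'.2) (hpr _ hS.2) (hpr _ hS'.2))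
    refine this.trans (le_of_eq ?_)
    rw [mul_one_div]
  have h1 : (F.card : ℝ) ≤ ∑ ρ : Bool, ∑ Z ∈ (Finset.range m).powerset,
      ((({S ∈ (Finset.range m).powerset | cubePoint N ρ Z S ∈ F}).card : ℕ) : ℝ) := by
    exact_mod_cast card_le_sum_cubePoint F
  have h2 : ∀ ρ : Bool, ∑ Z ∈ (Finset.range m).powerset,
      ((({S ∈ (Finset.range m).powerset | cubePoint N ρ Z S ∈ F}).card : ℕ) : ℝ) ≤
      2 ^ m * (2 ^ m * (R * (2 / √(m + 1)) + t)) := by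
    intro ρ
    refine (Finset.sum_le_sum (hfib ρ)).trans ?_
    rw [← Finset.mul_sum, Finset.sum_add_distrib, ← Finset.mul_sum, Finset.sum_const,
      Finset.card_powerset, Finset.card_range, nsmul_eq_mul]
    push_cast
    have := mul_le_mul_of_nonneg_left (sum_inv_sqrt_card_le m) (Nat.cast_nonneg _ : 0 ≤ R)
    have h4 : (2 : ℝ) ^ m * (R * (2 / √(m + 1)) + t) =
        R * (2 ^ m * (2 / √(m + 1))) + 2 ^ m * t := by ring
    rw [h4]
    gcongr
  refine h1.trans ((Finset.sum_le_sum fun ρ _ => h2 ρ).trans ?_)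
  rw [Finset.sum_const, Finset.card_univ, Fintype.card_bool, nsmul_eq_mul, ← mul_assoc (2 ^ m),
    ← pow_add]
  push_cast
  have h3 : (2 : ℝ) ^ (m + m) ≤ 2 ^ N := pow_le_pow_right₀ (by norm_num) (by omega)
  have h5 : 0 ≤ R * (2 / √(m + 1)) + t := by positivity
  rw [← mul_assoc]
  gcongr

end Anticoncentration

section Geometry

/-- The square of the Hilbert–Schmidt norm of a `2 × 2` matrix. -/
def hs (g : Matrix (Fin 2) (Fin 2) ℝ) : ℝ := g 0 0 ^ 2 + g 0 1 ^ 2 + g 1 0 ^ 2 + g 1 1 ^ 2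

/-- For `g ∈ SL₂(ℝ)`, the squared norm of `g⁻¹` applied to the unit vector of argument `a`. -/
def invNormSq (g : Matrix (Fin 2) (Fin 2) ℝ) (a : ℝ) : ℝ :=
  (g 1 1 * Real.cos a - g 0 1 * Real.sin a) ^ 2 + (g 0 0 * Real.sin a - g 1 0 * Real.cos a) ^ 2

lemma coe_eq_coe_iff_two_pi {x y : ℝ} :
    (x : AddCircle (2 * Real.pi)) = y ↔ ∃ k : ℤ, x - y = 2 * Real.pi * k :=
  Real.Angle.angle_eq_iff_two_pi_dvd_sub

lemma tauMap_coe (g : Matrix (Fin 2) (Fin 2) ℝ) (θ : ℝ) :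
    tauMap g (θ : AddCircle (2 * Real.pi)) = tauC g θ := by
  have h : (θ : AddCircle (2 * Real.pi)) ∈
      (fun x : ℝ => (x : AddCircle (2 * Real.pi))) '' Set.Ico 0 (0 + 2 * Real.pi) := by
    rw [AddCircle.coe_image_Ico_eq]; trivial
  obtain ⟨x, hx, hxθ⟩ := h
  obtain ⟨k, hk⟩ := coe_eq_coe_iff_two_pi.1 hxθ
  have hθ : x = θ + k * (2 * Real.pi) := by linarith
  have : tauMap g (x : AddCircle (2 * Real.pi)) = tauC g x := AddCircle.liftIco_coe_apply hx
  rw [← hxθ, this, tauC, tauC, hθ, Real.cos_add_int_mul_two_pi, Real.sin_add_int_mul_two_pi]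

lemma exists_of_tauC_mem_arc {g : Matrix (Fin 2) (Fin 2) ℝ} (hg : g.det = 1) {a l θ : ℝ}
    (h : tauC g θ ∈ arc a l) :
    ∃ s r : ℝ, 0 < s ∧ s < l ∧ 0 < r ∧
      g 0 0 * Real.cos θ + g 0 1 * Real.sin θ = r * Real.cos (a + s) ∧
      g 1 0 * Real.cos θ + g 1 1 * Real.sin θ = r * Real.sin (a + s) := by
  obtain ⟨t, ⟨ht1, ht2⟩, ht⟩ := h
  obtain ⟨k, hk⟩ := coe_eq_coe_iff_two_pi.1 ht
  set z : ℂ := ((g 0 0 * Real.cos θ + g 0 1 * Real.sin θ : ℝ) : ℂ) +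
      Complex.I * (g 1 0 * Real.cos θ + g 1 1 * Real.sin θ : ℝ) with hz
  have hre : z.re = g 0 0 * Real.cos θ + g 0 1 * Real.sin θ := by
    rw [hz, Complex.add_re, Complex.re_mul_ofReal, Complex.ofReal_re, Complex.I_re]; ring
  have him : z.im = g 1 0 * Real.cos θ + g 1 1 * Real.sin θ := by
    rw [hz, Complex.add_im, Complex.im_mul_ofReal, Complex.ofReal_im, Complex.I_im]; ring
  have harg : t = z.arg + k * (2 * Real.pi) := by linarith
  have hz0 : z ≠ 0 := by
    intro h0
    have h1 := congrArg Complex.re h0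
    have h2 := congrArg Complex.im h0
    rw [hre, Complex.zero_re] at h1
    rw [him, Complex.zero_im] at h2
    rw [Matrix.det_fin_two] at hg
    have e1 : Real.cos θ = 0 := by
      linear_combination (-Real.cos θ) * hg + g 1 1 * h1 - g 0 1 * h2
    have e2 : Real.sin θ = 0 := by
      linear_combination (-Real.sin θ) * hg - g 1 0 * h1 + g 0 0 * h2
    have := Real.sin_sq_add_cos_sq θ
    rw [e1, e2] at this
    norm_num at this
  refine ⟨t - a, ‖z‖, by linarith, by linarith, norm_pos_iff.2 hz0, ?_, ?_⟩
  · rw [← hre, add_sub_cancel, harg, Real.cos_add_int_mul_two_pi, Complex.norm_mul_cos_arg]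
  · rw [← him, add_sub_cancel, harg, Real.sin_add_int_mul_two_pi, Complex.norm_mul_sin_arg]

lemma one_le_invNormSq_mul_hs {g : Matrix (Fin 2) (Fin 2) ℝ} (hg : g.det = 1) (a : ℝ) :
    1 ≤ invNormSq g a * hs g := by
  rw [Matrix.det_fin_two] at hg
  unfold invNormSq hs
  have hcs := Real.sin_sq_add_cos_sq a
  set c := Real.cos a
  set s := Real.sin a
  set P := g 1 1 * c - g 0 1 * s with hP
  set Q := g 0 0 * s - g 1 0 * c with hQ
  have h1 : P * (g 0 0 * c + g 1 0 * s) + Q * (g 1 1 * s + g 0 1 * c) = 1 := by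
    rw [hP, hQ]; linear_combination (s ^ 2 + c ^ 2) * hg + hcs
  have h2 : (g 0 0 * c + g 1 0 * s) ^ 2 + (g 1 1 * s + g 0 1 * c) ^ 2 + (P ^ 2 + Q ^ 2) =
      g 0 0 ^ 2 + g 0 1 ^ 2 + g 1 0 ^ 2 + g 1 1 ^ 2 := by
    rw [hP, hQ]
    linear_combination (g 0 0 ^ 2 + g 0 1 ^ 2 + g 1 0 ^ 2 + g 1 1 ^ 2) * hcs
  rw [← h2]
  nlinarith [sq_nonneg (P * (g 1 1 * s + g 0 1 * c) - Q * (g 0 0 * c + g 1 0 * s)),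
    sq_nonneg (P ^ 2 + Q ^ 2)]

lemma abs_cross_le {P Q P' Q' S l X H : ℝ} (hX : X ^ 2 = P ^ 2 + Q ^ 2)
    (hH : H = P ^ 2 + Q ^ 2 + (P' ^ 2 + Q' ^ 2)) (hl : 4 * H * l ^ 2 ≤ X ^ 2) (hS0 : 0 ≤ S)
    (hSl : S ≤ l) : |S * (P * P' + Q * Q')| ≤ X ^ 2 / 2 := by
  refine abs_le_of_sq_le_sq ?_ (by positivity)
  have c1 : (P * P' + Q * Q') ^ 2 ≤ X ^ 2 * H := by
    rw [hX, hH]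
    nlinarith [sq_nonneg (P * Q' - Q * P'), sq_nonneg (P ^ 2 + Q ^ 2)]
  calc (S * (P * P' + Q * Q')) ^ 2 = S ^ 2 * (P * P' + Q * Q') ^ 2 := by ring
    _ ≤ l ^ 2 * (X ^ 2 * H) := by gcongr
    _ = X ^ 2 / 4 * (4 * H * l ^ 2) := by ring
    _ ≤ X ^ 2 / 4 * X ^ 2 := by gcongr
    _ = (X ^ 2 / 2) ^ 2 := by ring

lemma sin_cos_sub_of_preimage {A B C D θ φ a s r l X : ℝ} (hdet : A * D - B * C = 1)
    (hX0 : 0 < X) (hP : X * Real.cos φ = D * Real.cos a - B * Real.sin a)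
    (hQ : X * Real.sin φ = A * Real.sin a - C * Real.cos a)
    (hl : 4 * (A ^ 2 + B ^ 2 + C ^ 2 + D ^ 2) * l ^ 2 ≤ X ^ 2) (hs0 : 0 < s) (hsl : s < l)
    (hr : 0 < r) (h1 : A * Real.cos θ + B * Real.sin θ = r * Real.cos (a + s))
    (h2 : C * Real.cos θ + D * Real.sin θ = r * Real.sin (a + s)) :
    0 < Real.cos (θ - φ) ∧ 0 < Real.sin (θ - φ) ∧ Real.sin (θ - φ) ≤ 8 / 3 * l / X ^ 2 := by
  set H := A ^ 2 + B ^ 2 + C ^ 2 + D ^ 2 with hH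
  have hca := Real.sin_sq_add_cos_sq a
  have hcφ := Real.sin_sq_add_cos_sq φ
  set P := D * Real.cos a - B * Real.sin a with hPd
  set Q := A * Real.sin a - C * Real.cos a with hQd
  set P' := -D * Real.sin a - B * Real.cos a with hPd'
  set Q' := A * Real.cos a + C * Real.sin a with hQd'
  have hX : X ^ 2 = P ^ 2 + Q ^ 2 := by
    rw [← hP, ← hQ]; linear_combination (-X ^ 2) * hcφ
  have hHs : P ^ 2 + Q ^ 2 + (P' ^ 2 + Q' ^ 2) = H := by
    rw [hPd, hQd, hPd', hQd', hH]; linear_combination (A ^ 2 + B ^ 2 + C ^ 2 + D ^ 2) * hca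
  have hPQ : P * Q' - Q * P' = 1 := by
    rw [hPd, hQd, hPd', hQd']
    linear_combination (Real.sin a ^ 2 + Real.cos a ^ 2) * hdet + hca
  have hcosθ : Real.cos θ = r * (Real.cos s * P + Real.sin s * P') := by
    rw [Real.cos_add] at h1
    rw [Real.sin_add] at h2
    rw [hPd, hPd']
    linear_combination (-Real.cos θ) * hdet + D * h1 - B * h2
  have hsinθ : Real.sin θ = r * (Real.cos s * Q + Real.sin s * Q') := by
    rw [Real.cos_add] at h1
    rw [Real.sin_add] at h2
    rw [hQd, hQd']
    linear_combination (-Real.sin θ) * hdet - C * h1 + A * h2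
  have hcos : X * Real.cos (θ - φ) = r * (Real.cos s * X ^ 2 + Real.sin s * (P * P' + Q * Q')) := by
    rw [Real.cos_sub, hX]
    linear_combination Real.cos θ * hP + Real.sin θ * hQ + P * hcosθ + Q * hsinθ
  have hsin : X * Real.sin (θ - φ) = r * Real.sin s := by
    rw [Real.sin_sub]
    linear_combination Real.sin θ * hP - Real.cos θ * hQ + P * hsinθ - Q * hcosθ +
      r * Real.sin s * hPQ
  have hX2 : 0 < X ^ 2 := by positivity
  have hXH : X ^ 2 ≤ H := by rw [hX, ← hHs]; linarith [sq_nonneg P', sq_nonneg Q']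
  have hl0 : 0 < l := hs0.trans hsl
  have hl2 : l ^ 2 ≤ 1 / 4 := by
    by_contra hcon
    push Not at hcon
    have : H * (1 / 4) < H * l ^ 2 := mul_lt_mul_of_pos_left hcon (by linarith)
    linarith
  have hss : s ^ 2 ≤ 1 / 4 := (pow_le_pow_left₀ hs0.le hsl.le 2).trans hl2
  have hs1 : s ≤ 1 / 2 := by nlinarith
  have hcoss : 7 / 8 ≤ Real.cos s := by
    have := Real.one_sub_sq_div_two_le_cos (x := s)
    linarith
  have hsins0 : 0 < Real.sin s := Real.sin_pos_of_pos_of_lt_pi hs0 (by linarith [Real.pi_gt_three])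
  have hsins : Real.sin s ≤ l := (Real.sin_le hs0.le).trans hsl.le
  have hcross : |Real.sin s * (P * P' + Q * Q')| ≤ X ^ 2 / 2 :=
    abs_cross_le hX hHs.symm hl hsins0.le hsins
  have hcross2 := (abs_le.1 hcross).1
  have hlow : r * (3 / 8 * X ^ 2) ≤ X * Real.cos (θ - φ) := by
    rw [hcos]
    gcongr
    have : 7 / 8 * X ^ 2 ≤ Real.cos s * X ^ 2 := by gcongr
    linarith
  have hcos0 : 0 < Real.cos (θ - φ) := by
    have : 0 < X * Real.cos (θ - φ) := lt_of_lt_of_le (by positivity) hlow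
    exact (pos_iff_pos_of_mul_pos this).1 hX0
  have hsin0 : 0 < Real.sin (θ - φ) := by
    have : 0 < X * Real.sin (θ - φ) := by rw [hsin]; positivity
    exact (pos_iff_pos_of_mul_pos this).1 hX0
  refine ⟨hcos0, hsin0, ?_⟩
  have hrX : r * (3 / 8 * X) ≤ 1 := by
    have h3 : X * (r * (3 / 8 * X)) ≤ X * Real.cos (θ - φ) := by
      refine le_trans (le_of_eq (by ring)) hlow
    exact (le_of_mul_le_mul_left h3 hX0).trans (Real.cos_le_one _)
  rw [le_div_iff₀ hX2]
  calc Real.sin (θ - φ) * X ^ 2 = X * (X * Real.sin (θ - φ)) := by ring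
    _ = X * (r * Real.sin s) := by rw [hsin]
    _ ≤ X * (r * l) := by gcongr
    _ = r * (3 / 8 * X) * (8 / 3 * l) := by ring
    _ ≤ 1 * (8 / 3 * l) := by gcongr
    _ = _ := one_mul _

lemma lt_of_sin_le {ψ y : ℝ} (h1 : -Real.pi ≤ ψ) (h2 : ψ < Real.pi) (hc : 0 < Real.cos ψ)
    (hs : 0 < Real.sin ψ) (hy : Real.sin ψ ≤ 8 / 3 * y) : 0 < ψ ∧ ψ < 5 * y := by
  have h0 : 0 < ψ := by
    by_contra h
    push Not at h
    exact hs.not_ge (Real.sin_nonpos_of_nonpos_of_neg_pi_le h h1)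
  have h3 : ψ ≤ Real.pi / 2 := by
    by_contra h
    push Not at h
    exact hc.not_ge (Real.cos_nonpos_of_pi_div_two_le_of_le h.le (by linarith))
  refine ⟨h0, ?_⟩
  have h4 := Real.mul_le_sin h0.le h3
  have hpi := Real.pi_lt_d2
  have hpi0 := Real.pi_pos
  have h5 : ψ ≤ Real.pi / 2 * (8 / 3 * y) := by
    have : ψ = Real.pi / 2 * (2 / Real.pi * ψ) := by field_simp
    rw [this]
    exact mul_le_mul_of_nonneg_left (h4.trans hy) (by positivity)
  have hy0 : 0 < y := by linarith
  nlinarith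

/-- The preimage of a short arc under the projective action lies in an arc whose length is
controlled by the contraction rate at the endpoint. -/
lemma tauMap_preimage_arc_subset {g : Matrix (Fin 2) (Fin 2) ℝ} (hg : g.det = 1) {a l : ℝ}
    (hl : 4 * hs g * l ^ 2 ≤ invNormSq g a) :
    ∃ φ, tauMap g ⁻¹' arc a l ⊆ arc φ (5 * (l / invNormSq g a)) := by
  have hpos : 0 < invNormSq g a := by
    have h1 := one_le_invNormSq_mul_hs hg a
    have h2 : 0 ≤ invNormSq g a := by unfold invNormSq; positivity
    refine h2.lt_of_ne fun h => ?_
    rw [← h] at h1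
    norm_num at h1
  set w : ℂ := ⟨g 1 1 * Real.cos a - g 0 1 * Real.sin a,
    g 0 0 * Real.sin a - g 1 0 * Real.cos a⟩ with hw
  have hwX : ‖w‖ ^ 2 = invNormSq g a := by
    rw [Complex.sq_norm, Complex.normSq_apply, invNormSq, hw]; ring
  have hw0 : 0 < ‖w‖ := by
    refine (norm_nonneg w).lt_of_ne fun h => ?_
    rw [← h] at hwX
    norm_num at hwX
    linarith
  refine ⟨w.arg, fun x hx => ?_⟩
  have hmem : x ∈ (fun θ : ℝ => (θ : AddCircle (2 * Real.pi))) ''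
      Set.Ico (w.arg - Real.pi) (w.arg - Real.pi + 2 * Real.pi) := by
    rw [AddCircle.coe_image_Ico_eq]; trivial
  obtain ⟨θ, ⟨hθ1, hθ2⟩, rfl⟩ := hmem
  rw [Set.mem_preimage, tauMap_coe] at hx
  obtain ⟨s, r, hs0, hsl, hr, e1, e2⟩ := exists_of_tauC_mem_arc hg hx
  rw [Matrix.det_fin_two] at hg
  obtain ⟨k1, k2, k3⟩ := sin_cos_sub_of_preimage hg hw0 (Complex.norm_mul_cos_arg w)
    (Complex.norm_mul_sin_arg w) (l := l) (by rw [hwX]; exact hl) hs0 hsl hr e1 e2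
  rw [hwX, mul_div_assoc] at k3
  obtain ⟨m1, m2⟩ := lt_of_sin_le (by linarith) (by linarith) k1 k2 k3
  exact ⟨θ, ⟨by linarith, by linarith⟩, rfl⟩

lemma arc_subset_iUnion {b L s : ℝ} {n : ℕ} (hs : 0 < s) (hL : L ≤ n * (s / 2)) :
    arc b L ⊆ ⋃ i ∈ Finset.range n, arc (b + i * (s / 2)) s := by
  rintro _ ⟨x, ⟨hx1, hx2⟩, rfl⟩
  set y := (x - b) / (s / 2) with hy
  have hxy : x = b + y * (s / 2) := by rw [hy]; field_simp; ring
  have hy0 : 0 < y := div_pos (by linarith) (by linarith)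
  have hyn : y < n := by rw [hy, div_lt_iff₀ (by linarith)]; linarith
  obtain ⟨i, hi⟩ : ∃ i, ⌈y⌉₊ = i + 1 := Nat.exists_eq_succ_of_ne_zero (Nat.ceil_pos.2 hy0).ne'
  have h1 : y ≤ i + 1 := by
    have := Nat.le_ceil y
    rw [hi] at this
    exact_mod_cast this
  have h2 : (i : ℝ) < y := Nat.lt_ceil.1 (by omega)
  have h3 : i < n := by exact_mod_cast h2.trans hyn
  simp only [Set.mem_iUnion, Finset.mem_range]
  refine ⟨i, h3, x, ⟨?_, ?_⟩, rfl⟩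
  · rw [hxy]; gcongr
  · rw [hxy]; nlinarith

lemma measure_le_of_subset_arc {ν : Measure (AddCircle (2 * Real.pi))}
    {f : AddCircle (2 * Real.pi) → AddCircle (2 * Real.pi)} {b L s : ℝ} {n : ℕ} {c : ENNReal}
    (hs : 0 < s) (hL : L ≤ n * (s / 2)) (hc : ∀ b', ν (f ⁻¹' arc b' s) ≤ c) :
    ν (f ⁻¹' arc b L) ≤ n * c := by
  have h1 : f ⁻¹' arc b L ⊆ ⋃ i ∈ Finset.range n, f ⁻¹' arc (b + i * (s / 2)) s := by
    have := Set.preimage_mono (f := f) (arc_subset_iUnion (b := b) hs hL)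
    simpa only [Set.preimage_iUnion] using this
  refine (measure_mono h1).trans ((measure_biUnion_finset_le _ _).trans ?_)
  refine (Finset.sum_le_sum fun i _ => hc _).trans (le_of_eq ?_)
  simp

lemma measure_arc_le_of_cover {ν : Measure (AddCircle (2 * Real.pi))} {b L s : ℝ} {n : ℕ}
    {c : ENNReal} (hs : 0 < s) (hL : L ≤ n * (s / 2)) (hc : ∀ b', ν (arc b' s) ≤ c) :
    ν (arc b L) ≤ n * c :=
  measure_le_of_subset_arc (f := id) hs hL hc

lemma arc_le_arcSupLe {ν : Measure (AddCircle (2 * Real.pi))} {b l s : ℝ} (h : l ≤ s) :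
    ν (arc b l) ≤ arcSupLe ν s :=
  le_iSup_of_le b (le_iSup_of_le l (le_iSup_of_le h le_rfl))

lemma arc_le_arcSupLt {ν : Measure (AddCircle (2 * Real.pi))} {b l s : ℝ} (h : l < s) :
    ν (arc b l) ≤ arcSupLt ν s :=
  le_iSup_of_le b (le_iSup_of_le l (le_iSup_of_le h le_rfl))

lemma two_le_hs {g : Matrix (Fin 2) (Fin 2) ℝ} (hg : g.det = 1) : 2 ≤ hs g := by
  rw [Matrix.det_fin_two] at hg
  unfold hs
  nlinarith [sq_nonneg (g 0 0 - g 1 1), sq_nonneg (g 0 1 + g 1 0)]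

/-- The a priori bound for preimages of arcs. -/
lemma measure_preimage_arc_le {ν : Measure (AddCircle (2 * Real.pi))}
    {g : Matrix (Fin 2) (Fin 2) ℝ} (hg : g.det = 1) {a l : ℝ} (hl0 : 0 < l) (hl1 : l ≤ 1) :
    ν (tauMap g ⁻¹' arc a l) ≤ ENNReal.ofReal (11 * hs g) * arcSupLe ν l := by
  have hH := two_le_hs hg
  set n := ⌈10 * hs g⌉₊ with hn
  have hn1 : 10 * hs g ≤ n := Nat.le_ceil _
  have hn2 : (n : ℝ) ≤ 11 * hs g := by
    have := Nat.ceil_lt_add_one (by linarith : 0 ≤ 10 * hs g)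
    linarith
  have hn0 : (0 : ℝ) < n := by linarith
  set s := 2 * l / n with hs_def
  have hs0 : 0 < s := by positivity
  have hsl : 5 * (s * hs g) ≤ l := by
    rw [hs_def, div_mul_eq_mul_div, mul_div_assoc', div_le_iff₀ hn0]
    nlinarith
  have key : ∀ b', ν (tauMap g ⁻¹' arc b' s) ≤ arcSupLe ν l := by
    intro b
    have h1 := one_le_invNormSq_mul_hs hg b
    have hX : 1 / hs g ≤ invNormSq g b := by
      rw [div_le_iff₀ (by linarith)]; exact h1
    have hX0 : 0 < invNormSq g b := lt_of_lt_of_le (by positivity) hX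
    obtain ⟨φ, hφ⟩ := tauMap_preimage_arc_subset (a := b) (l := s) hg (by
      refine le_trans ?_ hX
      rw [le_div_iff₀ (by linarith)]
      have : s * hs g ≤ 1 / 5 := by linarith
      have h0 : 0 ≤ s * hs g := by positivity
      nlinarith)
    refine (measure_mono hφ).trans (arc_le_arcSupLe (le_trans ?_ hsl))
    gcongr
    rw [div_le_iff₀ hX0, mul_assoc]
    nlinarith
  have h := measure_le_of_subset_arc (f := tauMap g) (b := a) (L := l) (n := n) hs0
    (by rw [hs_def]; field_simp; exact le_rfl) key
  refine h.trans ?_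
  gcongr
  rw [← ENNReal.ofReal_natCast]
  exact ENNReal.ofReal_le_ofReal hn2

end Geometry

section TransferMatrices

lemma transfer_eq_orb (lam E : ℝ) (ε : ℕ → ℝ) (N : ℕ) :
    transfer lam E N (fun j => ε j) =
      !![(orb lam E ε (1, 0) N).1, (orb lam E ε (0, 1) N).1;
        (orb lam E ε (1, 0) N).2, (orb lam E ε (0, 1) N).2] := by
  induction N with
  | zero =>
    simp [transfer, orb]
    exact Matrix.one_fin_two
  | succ N ih =>
    have : transfer lam E (N + 1) (fun j => ε j) =
        gE lam E (ε N) * transfer lam E N (fun j => ε j) := by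
      rw [transfer, List.ofFn_succ']
      simp [transfer, List.concat_eq_append, -List.ofFn_succ]
    rw [this, ih, gE, Matrix.mul_fin_two]
    simp [orb, sub_eq_add_neg]

lemma transferB_mul_apply (lam E : ℝ) {N : ℕ} (σ : Fin N → Bool) (h : Matrix (Fin 2) (Fin 2) ℝ)
    (j : Fin 2) :
    (transferB lam E N σ * h) 0 j = (orb lam E (pot σ) (h 0 j, h 1 j) N).1 ∧
      (transferB lam E N σ * h) 1 j = (orb lam E (pot σ) (h 0 j, h 1 j) N).2 := by
  have h1 : transferB lam E N σ = transfer lam E N (fun j => pot σ j) := by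
    simp [transferB, pot]
  rw [h1, transfer_eq_orb, orb_eq_combination (p := (h 0 j, h 1 j)) N]
  simp [Matrix.mul_apply, Fin.sum_univ_two]
  constructor <;> ring

lemma transferB_mul_det (lam E : ℝ) {N : ℕ} (σ : Fin N → Bool) {h : Matrix (Fin 2) (Fin 2) ℝ}
    (hh : h.det = 1) : (transferB lam E N σ * h).det = 1 := by
  have h1 : transferB lam E N σ = transfer lam E N (fun j => pot σ j) := by
    simp [transferB, pot]
  rw [Matrix.det_mul, hh, h1, transfer_eq_orb, Matrix.det_fin_two_of, mul_one]
  linarith [orb_det (lam := lam) (E := E) (ε := pot σ) N]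

lemma hs_transferB_mul_le (lam E : ℝ) {N : ℕ} (σ : Fin N → Bool) (h : Matrix (Fin 2) (Fin 2) ℝ) :
    hs (transferB lam E N σ * h) ≤ hsq lam E (pot σ) N * hs h := by
  have h0 := transferB_mul_apply lam E σ h 0
  have h1 := transferB_mul_apply lam E σ h 1
  have k0 := orb_normSq_le (lam := lam) (E := E) (ε := pot σ) (p := (h 0 0, h 1 0)) N
  have k1 := orb_normSq_le (lam := lam) (E := E) (ε := pot σ) (p := (h 0 1, h 1 1)) N
  unfold hs
  rw [h0.1, h0.2, h1.1, h1.2]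
  linarith

lemma projection_sq_le_invNormSq (lam E : ℝ) {N : ℕ} (σ : Fin N → Bool)
    (h : Matrix (Fin 2) (Fin 2) ℝ) (a : ℝ) (j : Fin 2) :
    (Real.sin a * (orb lam E (pot σ) (h 0 j, h 1 j) N).1 +
      -Real.cos a * (orb lam E (pot σ) (h 0 j, h 1 j) N).2) ^ 2 ≤
      invNormSq (transferB lam E N σ * h) a := by
  have h0 := transferB_mul_apply lam E σ h 0
  have h1 := transferB_mul_apply lam E σ h 1
  unfold invNormSq
  rw [h0.1, h0.2, h1.1, h1.2]
  fin_cases j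
  · refine le_trans (le_of_eq ?_) (le_add_of_nonneg_left (sq_nonneg _))
    simp only [Fin.zero_eta]
    ring
  · refine le_trans (le_of_eq ?_) (le_add_of_nonneg_right (sq_nonneg _))
    simp only [Fin.mk_one]
    ring

lemma column_normSq_le_opNorm_sq (h : Matrix (Fin 2) (Fin 2) ℝ) (j : Fin 2) :
    h 0 j ^ 2 + h 1 j ^ 2 ≤ opNorm h ^ 2 := by
  have h1 := (Matrix.toEuclideanCLM (𝕜 := ℝ) h).le_opNorm (EuclideanSpace.single j 1)
  rw [PiLp.norm_single, norm_one, mul_one] at h1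
  have h2 := pow_le_pow_left₀ (norm_nonneg _) h1 2
  rw [EuclideanSpace.norm_sq_eq] at h2
  simpa [Fin.sum_univ_two, opNorm, Matrix.ofLp_toEuclideanCLM] using h2

lemma opNorm_sq_le_hs (h : Matrix (Fin 2) (Fin 2) ℝ) : opNorm h ^ 2 ≤ hs h := by
  have h0 : 0 ≤ hs h := by unfold hs; positivity
  have : opNorm h ≤ √(hs h) := by
    refine ContinuousLinearMap.opNorm_le_bound _ (Real.sqrt_nonneg _) fun x => ?_
    refine le_of_sq_le_sq ?_ (by positivity)
    rw [mul_pow, Real.sq_sqrt h0, EuclideanSpace.norm_sq_eq, EuclideanSpace.norm_sq_eq]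
    simp only [Fin.sum_univ_two, Matrix.ofLp_toEuclideanCLM, Matrix.mulVec, dotProduct,
      Real.norm_eq_abs, sq_abs, hs]
    nlinarith [sq_nonneg (h 0 0 * x 1 - h 0 1 * x 0), sq_nonneg (h 1 0 * x 1 - h 1 1 * x 0)]
  calc opNorm h ^ 2 ≤ √(hs h) ^ 2 := pow_le_pow_left₀ (norm_nonneg _) this 2
    _ = hs h := Real.sq_sqrt h0

end TransferMatrices

section ClassCount

lemma two_div_sqrt_half_le {lam : ℝ} {N : ℕ} (hlam : 0 < lam) (hN : 1 ≤ N * lam ^ 2) :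
    2 / √((N / 2 : ℕ) + 1) ≤ 3 * lam := by
  have h1 : (N : ℝ) ≤ 2 * ((N / 2 : ℕ) + 1) := by
    have : N ≤ 2 * (N / 2 + 1) := by omega
    exact_mod_cast this
  set y : ℝ := (N / 2 : ℕ) + 1 with hy
  have hy0 : 0 < y := by positivity
  rw [div_le_iff₀ (Real.sqrt_pos.2 hy0)]
  refine le_of_sq_le_sq ?_ (by positivity)
  rw [mul_pow, Real.sq_sqrt hy0.le]
  nlinarith [sq_nonneg lam]

lemma block_count_le {lam K : ℝ} {q : ℕ} (hlam : 0 < lam) (hK : 1 ≤ K) (hq : 1 ≤ q)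
    (hlK : 96 * lam * K ^ 2 ≤ 1) :
    ∃ T : ℕ, 0 < T ∧ 48 * K ^ 2 * lam * T ≤ 1 ∧
      ((⌈4 * q / lam⌉₊ / T + 1 : ℕ) : ℝ) ≤ 481 * q * K ^ 2 := by
  have hc : 0 < 48 * K ^ 2 * lam := by positivity
  set x := 1 / (48 * K ^ 2 * lam) with hx
  have hx2 : 2 ≤ x := by rw [hx, le_div_iff₀ hc]; linarith
  have h1 : (⌊x⌋₊ : ℝ) ≤ x := Nat.floor_le (by linarith)
  have h2 : x < ⌊x⌋₊ + 1 := Nat.lt_floor_add_one x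
  have hTx : x / 2 ≤ ⌊x⌋₊ := by linarith
  have hT : (0 : ℝ) < ⌊x⌋₊ := by linarith
  refine ⟨⌊x⌋₊, by exact_mod_cast hT, ?_, ?_⟩
  · calc 48 * K ^ 2 * lam * ⌊x⌋₊ ≤ 48 * K ^ 2 * lam * x := by gcongr
      _ = 1 := by rw [hx]; field_simp
  · have hq' : (1 : ℝ) ≤ q := by exact_mod_cast hq
    have h3 : ((⌈4 * q / lam⌉₊ / ⌊x⌋₊ : ℕ) : ℝ) ≤ ⌈4 * q / lam⌉₊ / ⌊x⌋₊ := Nat.cast_div_le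
    have h4 : (⌈4 * q / lam⌉₊ : ℝ) < 4 * q / lam + 1 := Nat.ceil_lt_add_one (by positivity)
    have h5 : (⌈4 * q / lam⌉₊ : ℝ) / ⌊x⌋₊ ≤ (4 * q / lam + 1) / (x / 2) := by gcongr
    have h6 : (4 * q / lam + 1) / (x / 2) = 384 * q * K ^ 2 + 96 * lam * K ^ 2 := by
      rw [hx]; field_simp; ring
    have hqK : 1 ≤ q * K ^ 2 := one_le_mul_of_one_le_of_one_le hq' (one_le_pow₀ hK)
    push_cast
    linarith

lemma card_projection_le {lam E K δ : ℝ} {u p : ℝ × ℝ} {N q : ℕ} (hlam : 0 < lam) (hK : 1 ≤ K)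
    (hq : 1 ≤ q) (hlK : 96 * lam * K ^ 2 ≤ 1) (hqe : Real.exp (-(q : ℝ) ^ 2) ≤ lam)
    (hN1 : 1 ≤ N * lam ^ 2) (hN2 : N * lam ^ 2 ≤ 2) (hu : u.1 ^ 2 + u.2 ^ 2 = 1)
    (hp : 0 < p.1 ^ 2 + p.2 ^ 2) (hδ : lam ≤ δ) (F : Finset (Fin N → Bool))
    (hg : ∀ σ ∈ F, ∀ n ≤ N, hsq lam E (pot σ) n ≤ K)
    (hpr : ∀ σ ∈ F, (u.1 * (orb lam E (pot σ) p N).1 + u.2 * (orb lam E (pot σ) p N).2) ^ 2 ≤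
      δ ^ 2 * (p.1 ^ 2 + p.2 ^ 2)) :
    (F.card : ℝ) ≤ 2 ^ N * (8662 * q * K ^ 4 * δ) := by
  obtain ⟨T, hT0, hT, hTL⟩ := block_count_le hlam hK hq hlK
  have hδ0 : 0 < δ := hlam.trans_le hδ
  have hq' : (1 : ℝ) ≤ q := by exact_mod_cast hq
  have hK2 : 1 ≤ K ^ 2 := one_le_pow₀ hK
  set x := 2 * δ * K ^ 2 / lam with hx
  have hx0 : 0 ≤ x := by positivity
  have hk : 2 * δ * K ^ 2 < lam * ((⌊x⌋₊ : ℝ) + 1) := by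
    have := Nat.lt_floor_add_one x
    rw [hx, div_lt_iff₀ hlam] at this
    rw [mul_comm lam]
    exact this
  have hk1 : (⌊x⌋₊ : ℝ) + 1 ≤ 3 * δ * K ^ 2 / lam := by
    have h1 : (⌊x⌋₊ : ℝ) ≤ x := Nat.floor_le hx0
    have h2 : 1 ≤ δ * K ^ 2 / lam := by
      rw [le_div_iff₀ hlam, one_mul]
      nlinarith
    have h3 : 3 * δ * K ^ 2 / lam = x + δ * K ^ 2 / lam := by rw [hx]; ring
    linarith
  have hm : ((N / 2 : ℕ) : ℝ) ≤ 1 / lam ^ 2 := by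
    have h1 : ((N / 2 : ℕ) : ℝ) ≤ N / 2 := Nat.cast_div_le
    refine h1.trans ?_
    rw [le_div_iff₀ (by positivity)]
    linarith
  have main := card_small_projection_le (L := 4 * q / lam) (M := 1 / lam ^ 2) hlam hu hp hδ0.le
    hT0 hT hk (by positivity) (by positivity) hm F hg hpr
  have he : (4 * q / lam) ^ 2 / (2 * (1 / lam ^ 2)) = 8 * (q : ℝ) ^ 2 := by field_simp; norm_num
  have he2 : Real.exp (-(8 * (q : ℝ) ^ 2)) ≤ δ := by
    refine le_trans ?_ (hqe.trans hδ)
    rw [Real.exp_le_exp]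
    linarith [sq_nonneg (q : ℝ)]
  rw [he] at main
  refine main.trans ?_
  have hb := two_div_sqrt_half_le hlam hN1
  have hR : (((⌈4 * q / lam⌉₊ / T + 1) * (⌊x⌋₊ + 1) : ℕ) : ℝ) * (2 / √((N / 2 : ℕ) + 1)) ≤
      4329 * q * K ^ 4 * δ := by
    rw [Nat.cast_mul, Nat.cast_add_one ⌊x⌋₊]
    calc _ ≤ 481 * q * K ^ 2 * (3 * δ * K ^ 2 / lam) * (3 * lam) := by gcongr
      _ = _ := by field_simp; ring
  have hqK : δ ≤ q * K ^ 4 * δ :=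
    le_mul_of_one_le_left hδ0.le (one_le_mul_of_one_le_of_one_le hq' (one_le_pow₀ hK))
  rw [mul_comm 2, mul_assoc]
  refine mul_le_mul_of_nonneg_left ?_ (by positivity)
  linarith

end ClassCount

section Scales

/-- The relations between the parameters `λ = η ^ 30`, the growth threshold `K`, the moment `q`
and the number `N` of steps. -/
structure AdmissibleScale (lam η K : ℝ) (q N : ℕ) : Prop where
  eta_pos : 0 < η
  lam_eq : lam = η ^ 30
  one_le_threshold : 1 ≤ K
  threshold_mul_le : 8 * K * η ≤ 1
  one_le_moment : 1 ≤ q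
  exp_le : Real.exp (-(q : ℝ) ^ 2) ≤ lam
  one_le_steps : 1 ≤ N * lam ^ 2
  steps_le : N * lam ^ 2 ≤ 2

namespace AdmissibleScale

variable {lam η K : ℝ} {q N : ℕ}

lemma lam_pos (S : AdmissibleScale lam η K q N) : 0 < lam := by
  rw [S.lam_eq]; exact pow_pos S.eta_pos _

lemma eta_le (S : AdmissibleScale lam η K q N) : η ≤ 1 / 8 := by
  have := S.threshold_mul_le
  have := S.one_le_threshold
  have := S.eta_pos
  nlinarith

lemma pow_le_pow (S : AdmissibleScale lam η K q N) {m n : ℕ} (h : m ≤ n) : η ^ n ≤ η ^ m :=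
  pow_le_pow_of_le_one S.eta_pos.le (by linarith [S.eta_le]) h

lemma threshold_sq_le (S : AdmissibleScale lam η K q N) : 64 * K ^ 2 * η ^ 2 ≤ 1 := by
  have h := S.one_le_threshold
  have h1 := S.eta_pos
  have := pow_le_pow_left₀ (by positivity) S.threshold_mul_le 2
  linarith [this, show (8 * K * η) ^ 2 = 64 * K ^ 2 * η ^ 2 by ring]

lemma lam_mul_threshold_sq_le (S : AdmissibleScale lam η K q N) : 96 * lam * K ^ 2 ≤ 1 := by
  have h1 := S.threshold_sq_le
  have h2 := S.pow_le_pow (show 2 ≤ 30 by norm_num)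
  have h3 : η ^ 30 ≤ 1 / 8 * η ^ 2 := by
    have h4 := S.pow_le_pow (show 3 ≤ 30 by norm_num)
    have h5 := S.eta_le
    have h6 := S.eta_pos
    have : η * η ^ 2 ≤ 1 / 8 * η ^ 2 := by gcongr
    linarith [show η ^ 3 = η * η ^ 2 by ring]
  rw [S.lam_eq]
  have : η ^ 30 * K ^ 2 ≤ 1 / 8 * η ^ 2 * K ^ 2 := by gcongr
  linarith

lemma hs_mul_le (S : AdmissibleScale lam η K q N) {E : ℝ}
    {h : Matrix (Fin 2) (Fin 2) ℝ} (hhs : hs h * η ^ 6 ≤ 8) {σ : Fin N → Bool}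
    (hσ : hsq lam E (pot σ) N ≤ K) : hs (transferB lam E N σ * h) * η ^ 6 ≤ 8 * K := by
  have hη := S.eta_pos
  have hK := S.one_le_threshold
  have hhs0 : 0 ≤ hs h := by unfold hs; positivity
  calc _ ≤ hsq lam E (pot σ) N * hs h * η ^ 6 := by
        gcongr; exact hs_transferB_mul_le lam E σ h
    _ ≤ K * hs h * η ^ 6 := by gcongr
    _ = K * (hs h * η ^ 6) := by ring
    _ ≤ K * 8 := by gcongr
    _ = 8 * K := by ring

/-- Good products expand no direction much, and the preimages of short arcs under them are
contained in short arcs. -/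
lemma exists_arc (S : AdmissibleScale lam η K q N) {g : Matrix (Fin 2) (Fin 2) ℝ}
    (hg : g.det = 1) (hgK : hs g * η ^ 6 ≤ 8 * K) {l : ℝ} (hl0 : 0 < l) (hl : l < lam) (a : ℝ) :
    η ^ 6 ≤ 8 * K * invNormSq g a ∧
      ∃ φ, tauMap g ⁻¹' arc a l ⊆ arc φ (5 * (l / invNormSq g a)) := by
  have h1 := one_le_invNormSq_mul_hs hg a
  have hη := S.eta_pos
  have hK := S.one_le_threshold
  have hX0 : 0 ≤ invNormSq g a := by unfold invNormSq; positivity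
  have h6 : η ^ 6 ≤ 8 * K * invNormSq g a := by
    calc η ^ 6 = 1 * η ^ 6 := by ring
      _ ≤ invNormSq g a * hs g * η ^ 6 := by gcongr
      _ = invNormSq g a * (hs g * η ^ 6) := by ring
      _ ≤ invNormSq g a * (8 * K) := by gcongr
      _ = _ := by ring
  refine ⟨h6, tauMap_preimage_arc_subset hg ?_⟩
  have hl2 : l ^ 2 ≤ η ^ 60 := by
    calc l ^ 2 ≤ (η ^ 30) ^ 2 := by rw [← S.lam_eq]; gcongr
      _ = η ^ 60 := by ring
  have hc : 0 < η ^ 6 * (8 * K) := by positivity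
  refine le_of_mul_le_mul_right ?_ hc
  calc 4 * hs g * l ^ 2 * (η ^ 6 * (8 * K)) = 4 * (hs g * η ^ 6) * (8 * K) * l ^ 2 := by ring
    _ ≤ 4 * (8 * K) * (8 * K) * η ^ 60 := by gcongr
    _ = 4 * (64 * K ^ 2 * η ^ 2) * η ^ 58 := by ring
    _ ≤ 4 * 1 * η ^ 58 := by gcongr; exact S.threshold_sq_le
    _ ≤ η ^ 12 := by
      have := S.pow_le_pow (show 13 ≤ 58 by norm_num)
      have h3 : η ^ 13 ≤ η ^ 12 * (1 / 8) := by
        rw [pow_succ]; gcongr; exact S.eta_le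
      have : 0 < η ^ 12 := by positivity
      linarith
    _ = η ^ 6 * η ^ 6 := by ring
    _ ≤ η ^ 6 * (8 * K * invNormSq g a) := by gcongr
    _ = _ := by ring

lemma pow_four_le (S : AdmissibleScale lam η K q N) {t : ℝ} (ht0 : 0 < t)
    (ht : η ^ 6 ≤ 8 * K * t ^ 2) : η ^ 4 ≤ t := by
  have hη := S.eta_pos
  have hK := S.one_le_threshold
  refine le_of_sq_le_sq ?_ ht0.le
  calc (η ^ 4) ^ 2 = η ^ 2 * η ^ 6 := by ring
    _ ≤ η ^ 2 * (8 * K * t ^ 2) := by gcongr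
    _ = 8 * K * η * (η * t ^ 2) := by ring
    _ ≤ 1 * (1 * t ^ 2) := by
      gcongr
      · exact S.threshold_mul_le
      · linarith [S.eta_le]
    _ = t ^ 2 := by ring

lemma card_le (S : AdmissibleScale lam η K q N) {E t : ℝ} {u p : ℝ × ℝ}
    (hu : u.1 ^ 2 + u.2 ^ 2 = 1) (hp : 1 ≤ 2 * η ^ 6 * (p.1 ^ 2 + p.2 ^ 2)) (ht : η ^ 4 ≤ t)
    (F : Finset (Fin N → Bool)) (hg : ∀ σ ∈ F, ∀ n ≤ N, hsq lam E (pot σ) n ≤ K)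
    (hpr : ∀ σ ∈ F,
      (u.1 * (orb lam E (pot σ) p N).1 + u.2 * (orb lam E (pot σ) p N).2) ^ 2 ≤ t ^ 2) :
    (F.card : ℝ) ≤ 2 ^ N * (17324 * q * K ^ 4 * (t * η ^ 3)) := by
  have hη := S.eta_pos
  have hp0 : 0 < p.1 ^ 2 + p.2 ^ 2 := by
    by_contra h
    push Not at h
    have : 2 * η ^ 6 * (p.1 ^ 2 + p.2 ^ 2) ≤ 0 :=
      mul_nonpos_of_nonneg_of_nonpos (by positivity) h
    linarith
  have hlt : lam ≤ 2 * (t * η ^ 3) := by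
    have h1 : η ^ 4 * η ^ 3 ≤ t * η ^ 3 := by gcongr
    have h2 := S.pow_le_pow (show 7 ≤ 30 by norm_num)
    rw [S.lam_eq]
    linarith [show η ^ 4 * η ^ 3 = η ^ 7 by ring, pow_pos hη 7]
  have := card_projection_le S.lam_pos S.one_le_threshold S.one_le_moment
    S.lam_mul_threshold_sq_le S.exp_le S.one_le_steps S.steps_le hu hp0 hlt F hg fun σ hσ => by
      refine (hpr σ hσ).trans ?_
      have := le_mul_of_one_le_left (sq_nonneg t) hp
      linarith [show (2 * (t * η ^ 3)) ^ 2 * (p.1 ^ 2 + p.2 ^ 2) =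
        2 * (2 * η ^ 6 * (p.1 ^ 2 + p.2 ^ 2) * t ^ 2) by ring, sq_nonneg t]
  refine this.trans (le_of_eq ?_)
  ring

end AdmissibleScale

end Scales

section ClassSum

lemma sum_le_of_card_mul_le {α : Type*} (F : Finset α) (f : α → ENNReal) {n N : ℕ} {W x : ℝ}
    {c : ENNReal} (hW : 0 ≤ W) (hf : ∀ σ ∈ F, f σ ≤ n * c)
    (hn : (F.card : ℝ) * n ≤ 2 ^ N * (W * x)) :
    ∑ σ ∈ F, f σ ≤ 2 ^ N * (ENNReal.ofReal W * (ENNReal.ofReal x * c)) := by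
  refine (Finset.sum_le_sum hf).trans ?_
  rw [Finset.sum_const, nsmul_eq_mul, ← mul_assoc]
  have h := ENNReal.ofReal_le_ofReal hn
  rw [ENNReal.ofReal_mul (by positivity), ENNReal.ofReal_mul (by positivity),
    ENNReal.ofReal_mul hW, ENNReal.ofReal_pow (by norm_num), ENNReal.ofReal_natCast,
    ENNReal.ofReal_natCast, ENNReal.ofReal_ofNat] at h
  calc _ ≤ 2 ^ N * (ENNReal.ofReal W * ENNReal.ofReal x) * c := by gcongr
    _ = _ := by ring

/-- The supremum over dilation factors `r < D < s` of the `D⁻¹`-weighted measures of arcs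
shorter than `D * l`. -/
def dilationSup (ν : Measure (AddCircle (2 * Real.pi))) (r s l : ℝ) : ENNReal :=
  ⨆ (D : ℝ) (_ : D ∈ Set.Ioo r s), ENNReal.ofReal D⁻¹ * arcSupLt ν (D * l)

/-- Constant in the estimate for one class of good sequences. -/
def classConst (K Q : ℝ) (q : ℕ) : ℝ := 5561004 * q * K ^ 5 * Q

lemma wide_cover_count_le {B c Q t η K : ℝ} {q n : ℕ} (hη : 0 < η) (hK : 1 ≤ K)
    (hQ : 1 ≤ Q) (ht : η ^ 2 ≤ t) (ht2 : t * η ^ 2 ≤ 1) (hB : 0 ≤ B)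
    (hn : (n : ℝ) ≤ 10 * Q / t ^ 2 + 1)
    (hc : c ≤ B * (17324 * q * K ^ 4 * (t * η ^ 3))) :
    c * n ≤ B * (classConst K Q q * η) := by
  have ht0 : 0 < t := lt_of_lt_of_le (by positivity) ht
  have h1 : t * η ^ 3 * (10 * Q / t ^ 2 + 1) ≤ 11 * Q * η := by
    have e1 : t * η ^ 3 * (10 * Q / t ^ 2) ≤ 10 * Q * η := by
      rw [mul_div_assoc', div_le_iff₀ (by positivity)]
      have : 10 * Q * η * t * η ^ 2 ≤ 10 * Q * η * t * t := by gcongr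
      linarith
    have e2 : t * η ^ 3 ≤ Q * η := by
      have : t * η ^ 2 * η ≤ Q * η := by
        gcongr
        linarith
      linarith
    linarith
  calc c * n ≤ B * (17324 * q * K ^ 4 * (t * η ^ 3)) * (10 * Q / t ^ 2 + 1) := by gcongr
    _ = B * (17324 * q * K ^ 4 * (t * η ^ 3 * (10 * Q / t ^ 2 + 1))) := by ring
    _ ≤ B * (17324 * q * K ^ 4 * (11 * Q * η)) := by gcongr
    _ ≤ B * (classConst K Q q * η) := by
      unfold classConst
      gcongr ?_ * ?_
      have : (q : ℝ) * K ^ 4 * Q * η ≤ q * K ^ 5 * Q * η := by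
        gcongr
        norm_num
      have h0 : 0 ≤ (q : ℝ) * K ^ 4 * Q * η := by positivity
      linarith

lemma narrow_cover_count_le {B c Q t η K D : ℝ} {q n : ℕ} (hη : 0 < η) (hK : 1 ≤ K)
    (hQ : 1 ≤ Q) (ht0 : 0 < t) (hB : 0 ≤ B) (hD0 : 0 < D) (hD1 : D * t ^ 2 ≤ 1)
    (hD2 : D * η ^ 6 ≤ 1) (hn : (n : ℝ) ≤ 320 * K * Q + 1)
    (hc : c ≤ B * (17324 * q * K ^ 4 * (t * η ^ 3))) :
    c * n ≤ B * (classConst K Q q * D⁻¹) := by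
  have h1 : t * η ^ 3 ≤ D⁻¹ := by
    rw [← one_div, le_div_iff₀ hD0]
    refine le_of_sq_le_sq ?_ zero_le_one
    calc (t * η ^ 3 * D) ^ 2 = D * t ^ 2 * (D * η ^ 6) := by ring
      _ ≤ 1 * 1 := by gcongr
      _ = 1 ^ 2 := by norm_num
  have h2 : (n : ℝ) ≤ 321 * K * Q := by
    have : 1 ≤ K * Q := one_le_mul_of_one_le_of_one_le hK hQ
    linarith
  calc c * n ≤ B * (17324 * q * K ^ 4 * (t * η ^ 3)) * (321 * K * Q) := by gcongr
    _ ≤ B * (17324 * q * K ^ 4 * D⁻¹) * (321 * K * Q) := by gcongr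
    _ = _ := by unfold classConst; ring

/-- The dilation factor used for the directions contracted to scale `t < η ^ 2`. -/
lemma exists_dilation {t η K : ℝ} (hη : 0 < η) (hη1 : η ≤ 1 / 8) (hK : 1 ≤ K) (ht0 : 0 < t)
    (ht : t < η ^ 2) (htK : η ^ 6 ≤ 8 * K * t ^ 2) :
    ∃ D, (η ^ 3)⁻¹ < D ∧ D < (η ^ 6)⁻¹ ∧ D * t ^ 2 ≤ 1 ∧ 1 ≤ 16 * K * (D * t ^ 2) := by
  have h6 : 0 < (η ^ 6)⁻¹ := by positivity
  have hη1' : η < 1 := by linarith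
  refine ⟨min (t ^ 2)⁻¹ ((η ^ 6)⁻¹ / 2), lt_min ?_ ?_, ?_, ?_, ?_⟩
  · refine inv_strictAnti₀ (by positivity) ?_
    calc t ^ 2 < (η ^ 2) ^ 2 := by gcongr
      _ = η ^ 4 := by ring
      _ ≤ η ^ 3 := pow_le_pow_of_le_one hη.le hη1'.le (by norm_num)
  · have h3 : η ^ 3 < 1 / 2 := by
      have : η ^ 3 ≤ η := by simpa using pow_le_pow_of_le_one hη.le hη1'.le (show 1 ≤ 3 by norm_num)
      linarith
    have : (η ^ 6)⁻¹ / 2 = (η ^ 3)⁻¹ * ((η ^ 3)⁻¹ / 2) := by field_simp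
    rw [this]
    refine lt_mul_of_one_lt_right (by positivity) ?_
    rw [lt_div_iff₀ (by norm_num), ← one_div, lt_div_iff₀ (by positivity)]
    linarith
  · exact (min_le_right _ _).trans_lt (by linarith)
  · calc _ ≤ (t ^ 2)⁻¹ * t ^ 2 := by gcongr; exact min_le_left _ _
      _ = 1 := inv_mul_cancel₀ (by positivity)
  · rcases min_choice (t ^ 2)⁻¹ ((η ^ 6)⁻¹ / 2) with h | h <;> rw [h]
    · rw [inv_mul_cancel₀ (by positivity)]; linarith
    · have : 16 * K * ((η ^ 6)⁻¹ / 2 * t ^ 2) = 8 * K * t ^ 2 / η ^ 6 := by field_simp; norm_num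
      rw [this, le_div_iff₀ (by positivity)]
      linarith

variable {lam η K : ℝ} {q N : ℕ}

/-- Contribution of the good sequences for which the contraction rate is comparable to `t`. -/
lemma AdmissibleScale.sum_class_le (S : AdmissibleScale lam η K q N)
    {ν : Measure (AddCircle (2 * Real.pi))} {E Q t a l : ℝ} {h : Matrix (Fin 2) (Fin 2) ℝ}
    (hh : h.det = 1) (hhs : hs h * η ^ 6 ≤ 8) {j : Fin 2}
    (hp : 1 ≤ 2 * η ^ 6 * (h 0 j ^ 2 + h 1 j ^ 2)) (hl0 : 0 < l) (hl : l < lam) (hQ : 1 ≤ Q)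
    (ht0 : 0 < t) (htη : t * η ^ 2 ≤ 1) (F : Finset (Fin N → Bool))
    (hg : ∀ σ ∈ F, ∀ n ≤ N, hsq lam E (pot σ) n ≤ K)
    (hlow : ∀ σ ∈ F, t ^ 2 ≤ Q * invNormSq (transferB lam E N σ * h) a)
    (hup : ∀ σ ∈ F, invNormSq (transferB lam E N σ * h) a ≤ t ^ 2) :
    ∑ σ ∈ F, ν (tauMap (transferB lam E N σ * h) ⁻¹' arc a l) ≤
      2 ^ N * (ENNReal.ofReal (classConst K Q q) *
        (ENNReal.ofReal η * arcSupLe ν l + dilationSup ν (η ^ 3)⁻¹ (η ^ 6)⁻¹ l)) := by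
  have hη := S.eta_pos
  have hK := S.one_le_threshold
  rcases F.eq_empty_or_nonempty with rfl | ⟨σ₀, hσ₀⟩
  · simp
  have harc : ∀ σ ∈ F, η ^ 6 ≤ 8 * K * invNormSq (transferB lam E N σ * h) a ∧
      ∃ φ, tauMap (transferB lam E N σ * h) ⁻¹' arc a l ⊆
        arc φ (5 * (l / invNormSq (transferB lam E N σ * h) a)) := by
    intro σ hσ
    exact S.exists_arc (transferB_mul_det lam E σ hh)
      (S.hs_mul_le hhs (hg σ hσ N le_rfl)) hl0 hl a
  have htK : η ^ 6 ≤ 8 * K * t ^ 2 := by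
    refine (harc σ₀ hσ₀).1.trans ?_
    gcongr
    exact hup σ₀ hσ₀
  have hcard := S.card_le (u := (Real.sin a, -Real.cos a)) (p := (h 0 j, h 1 j))
    (by simp) hp (S.pow_four_le ht0 htK) F hg
    fun σ hσ => (projection_sq_le_invNormSq lam E σ h a j).trans (hup σ hσ)
  have hlen : ∀ σ ∈ F, 5 * (l / invNormSq (transferB lam E N σ * h) a) ≤ 5 * l * Q / t ^ 2 := by
    intro σ hσ
    have hX : 0 < invNormSq (transferB lam E N σ * h) a := by
      have := (harc σ hσ).1
      have h6 : 0 < η ^ 6 := by positivity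
      exact pos_of_mul_pos_right (h6.trans_le this) (by positivity)
    rw [mul_div_assoc', div_le_div_iff₀ hX (by positivity)]
    have := mul_le_mul_of_nonneg_left (hlow σ hσ) (by positivity : 0 ≤ 5 * l)
    linarith
  have hW : 0 ≤ classConst K Q q := by unfold classConst; positivity
  have hB : (0 : ℝ) ≤ 2 ^ N := by positivity
  rcases le_or_gt (η ^ 2) t with htt | htt
  · set n := ⌈10 * Q / t ^ 2⌉₊ with hn
    have hn1 : 10 * Q / t ^ 2 ≤ n := Nat.le_ceil _
    have hn2 : (n : ℝ) ≤ 10 * Q / t ^ 2 + 1 := (Nat.ceil_lt_add_one (by positivity)).le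
    refine (sum_le_of_card_mul_le F _ (n := n) (c := arcSupLe ν l) hW ?_
      (wide_cover_count_le hη hK hQ htt htη hB hn2 hcard)).trans
      (by gcongr; exact le_self_add)
    intro σ hσ
    obtain ⟨φ, hφ⟩ := (harc σ hσ).2
    refine (measure_mono hφ).trans (measure_arc_le_of_cover hl0 ?_ fun b => arc_le_arcSupLe le_rfl)
    refine (hlen σ hσ).trans ?_
    calc 5 * l * Q / t ^ 2 = 10 * Q / t ^ 2 * (l / 2) := by ring
      _ ≤ n * (l / 2) := by gcongr
  · obtain ⟨D, hD1, hD2, hD3, hD4⟩ := exists_dilation hη S.eta_le hK ht0 htt htK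
    have hD0 : 0 < D := lt_trans (by positivity) hD1
    set n := ⌈320 * K * Q⌉₊ with hn
    have hn1 : 320 * K * Q ≤ n := Nat.le_ceil _
    have hn2 : (n : ℝ) ≤ 320 * K * Q + 1 := (Nat.ceil_lt_add_one (by positivity)).le
    have hD6 : D * η ^ 6 ≤ 1 := by
      rw [← one_div, lt_div_iff₀ (by positivity)] at hD2
      exact hD2.le
    refine (sum_le_of_card_mul_le F _ (n := n) (c := arcSupLt ν (D * l)) hW ?_
      (narrow_cover_count_le hη hK hQ ht0 hB hD0 hD3 hD6 hn2 hcard)).trans ?_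
    · intro σ hσ
      obtain ⟨φ, hφ⟩ := (harc σ hσ).2
      have hDl : 0 < D * l := by positivity
      refine (measure_mono hφ).trans (measure_arc_le_of_cover (s := D * l / 2) (by positivity) ?_
        fun b => arc_le_arcSupLt (by linarith))
      refine (hlen σ hσ).trans ?_
      calc 5 * l * Q / t ^ 2 = 5 * l * Q / t ^ 2 * 1 := by ring
        _ ≤ 5 * l * Q / t ^ 2 * (16 * K * (D * t ^ 2)) := by gcongr
        _ = 320 * K * Q * (D * l / 2 / 2) := by field_simp; ring
        _ ≤ n * (D * l / 2 / 2) := by gcongr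
    · gcongr
      refine le_trans ?_ le_add_self
      exact le_iSup₂_of_le (f := fun (D : ℝ) (_ : D ∈ Set.Ioo (η ^ 3)⁻¹ (η ^ 6)⁻¹) =>
        ENNReal.ofReal D⁻¹ * arcSupLt ν (D * l)) D ⟨hD1, hD2⟩ le_rfl

end ClassSum

section Assembly

variable {lam η K : ℝ} {q N : ℕ}

/-- Contribution of the sequences whose partial products grow beyond the threshold. -/
lemma AdmissibleScale.sum_large_le (S : AdmissibleScale lam η K q N)
    {ν : Measure (AddCircle (2 * Real.pi))} {δ E a l : ℝ} (hδ : 0 < δ) (hE : |E| ≤ 2 - δ)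
    (hKq : K = Real.exp ((4 * momentExp δ + 4) * q))
    {h : Matrix (Fin 2) (Fin 2) ℝ} (hh : h.det = 1) (hhs : hs h * η ^ 6 ≤ 8) (hl0 : 0 < l)
    (hl : l < lam) (F : Finset (Fin N → Bool))
    (hF : ∀ σ ∈ F, ∃ n ≤ N, K < hsq lam E (pot σ) n) :
    ∑ σ ∈ F, ν (tauMap (transferB lam E N σ * h) ⁻¹' arc a l) ≤
      2 ^ N * (ENNReal.ofReal η * arcSupLe ν l) := by
  have hη := S.eta_pos
  have hlam := S.lam_pos
  have hK := S.one_le_threshold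
  have hq : (1 : ℝ) ≤ q := by exact_mod_cast S.one_le_moment
  have hhs0 : 0 ≤ hs h := by linarith [two_le_hs hh]
  have hlη : lam ≤ η ^ 8 := by rw [S.lam_eq]; exact S.pow_le_pow (by norm_num)
  have hl1 : l ≤ 1 := by
    have := pow_le_one₀ (n := 8) hη.le (by linarith [S.eta_le])
    linarith
  have hN : (N : ℝ) + 1 ≤ 3 / lam ^ 2 := by
    rw [le_div_iff₀ (by positivity)]
    have : lam ^ 2 ≤ 1 := by
      have : lam ≤ 1 := hlη.trans (pow_le_one₀ hη.le (by linarith [S.eta_le]))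
      exact pow_le_one₀ hlam.le this
    linarith [S.steps_le]
  have hm0 : 0 ≤ momentExp δ := by unfold momentExp; positivity
  have hmom := sum_hsq_of_large_le (q := q) hδ hE S.steps_le (by linarith) F hF
  set V := ∑ σ ∈ F, hsq lam E (pot σ) N with hV
  have hKpow : K ^ q = Real.exp ((4 * momentExp δ + 4) * q ^ 2) := by
    rw [hKq, ← Real.exp_nat_mul]; ring_nf
  have hexp : Real.exp (momentExp δ * (q + 1 : ℕ) ^ 2) ≤ lam ^ 4 * K ^ q := by
    calc _ ≤ Real.exp (-(q : ℝ) ^ 2) ^ 4 * (Real.exp ((q : ℝ) ^ 2) ^ 4 *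
          Real.exp (momentExp δ * (2 * q) ^ 2)) := by
          rw [← mul_assoc, ← mul_pow, ← Real.exp_add, neg_add_cancel, Real.exp_zero, one_pow,
            one_mul]
          push_cast
          gcongr
          linarith
      _ = Real.exp (-(q : ℝ) ^ 2) ^ 4 * K ^ q := by
          rw [hKpow, ← Real.exp_nat_mul ((q : ℝ) ^ 2), ← Real.exp_add]
          congr 2
          push_cast
          ring
      _ ≤ lam ^ 4 * K ^ q := by gcongr; exact S.exp_le
  have hVle : V ≤ 2 ^ N * (3 * lam ^ 2) := by
    have hKp : 0 < K ^ q := by positivity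
    refine le_of_mul_le_mul_right ?_ hKp
    calc V * K ^ q ≤ (N + 1) * (2 ^ N * Real.exp (momentExp δ * (q + 1 : ℕ) ^ 2)) := hmom
      _ ≤ 3 / lam ^ 2 * (2 ^ N * (lam ^ 4 * K ^ q)) := by gcongr
      _ = _ := by field_simp
  have hfin : 11 * hs h * V ≤ 2 ^ N * η := by
    have h16 : lam ^ 2 ≤ η ^ 16 := by
      calc lam ^ 2 ≤ (η ^ 8) ^ 2 := by gcongr
        _ = η ^ 16 := by ring
    have h9 : 264 * η ^ 9 ≤ 1 := by
      have := pow_le_pow_left₀ hη.le S.eta_le 9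
      norm_num at this
      linarith
    calc 11 * hs h * V ≤ 11 * hs h * (2 ^ N * (3 * lam ^ 2)) := by gcongr
      _ ≤ 11 * hs h * (2 ^ N * (3 * η ^ 16)) := by gcongr
      _ = 33 * 2 ^ N * (hs h * η ^ 6) * η ^ 10 := by ring
      _ ≤ 33 * 2 ^ N * 8 * η ^ 10 := by gcongr
      _ = 2 ^ N * η * (264 * η ^ 9) := by ring
      _ ≤ 2 ^ N * η * 1 := by gcongr
      _ = _ := mul_one _
  calc _ ≤ ∑ σ ∈ F, ENNReal.ofReal (11 * hs h * hsq lam E (pot σ) N) * arcSupLe ν l := by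
        refine Finset.sum_le_sum fun σ _ =>
          (measure_preimage_arc_le (transferB_mul_det lam E σ hh) hl0 hl1).trans ?_
        refine mul_le_mul' (ENNReal.ofReal_le_ofReal ?_) le_rfl
        linarith [hs_transferB_mul_le lam E σ h]
    _ = ENNReal.ofReal (11 * hs h * V) * arcSupLe ν l := by
        rw [← Finset.sum_mul, ← ENNReal.ofReal_sum_of_nonneg, Finset.mul_sum]
        intro σ _
        have := zero_le_one.trans (one_le_hsq (lam := lam) (E := E) (ε := pot σ) N)
        positivity
    _ ≤ ENNReal.ofReal (2 ^ N * η) * arcSupLe ν l := by gcongr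
    _ = _ := by
        rw [ENNReal.ofReal_mul (by positivity), ENNReal.ofReal_pow (by norm_num),
          ENNReal.ofReal_ofNat, mul_assoc]

/-- Contribution of the good sequences contracting strongly at the endpoint of the arc. -/
lemma AdmissibleScale.sum_contracting_le (S : AdmissibleScale lam η K q N)
    {ν : Measure (AddCircle (2 * Real.pi))} {E a l : ℝ}
    {h : Matrix (Fin 2) (Fin 2) ℝ} (hh : h.det = 1) (hhs : hs h * η ^ 6 ≤ 8) (hl0 : 0 < l)
    (hl : l < lam) (F : Finset (Fin N → Bool))
    (hg : ∀ σ ∈ F, ∀ n ≤ N, hsq lam E (pot σ) n ≤ K)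
    (hY : ∀ σ ∈ F, 1 ≤ η ^ 4 * invNormSq (transferB lam E N σ * h) a) :
    ∑ σ ∈ F, ν (tauMap (transferB lam E N σ * h) ⁻¹' arc a l) ≤
      2 ^ N * arcSupLt ν (η ^ 3 * l) := by
  have hη := S.eta_pos
  have hhs0 : 0 ≤ hs h := by linarith [two_le_hs hh]
  have hcard : (F.card : ENNReal) ≤ 2 ^ N := by
    have : F.card ≤ 2 ^ N := by simpa using F.card_le_univ
    exact_mod_cast this
  calc _ ≤ ∑ σ ∈ F, arcSupLt ν (η ^ 3 * l) := by
        refine Finset.sum_le_sum fun σ hσ => ?_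
        have hK := S.one_le_threshold
        obtain ⟨h6, φ, hφ⟩ := S.exists_arc (transferB_mul_det lam E σ hh) 
          (S.hs_mul_le hhs (hg σ hσ N le_rfl)) hl0 hl a
        refine (measure_mono hφ).trans (arc_le_arcSupLt ?_)
        have hX : 0 < invNormSq (transferB lam E N σ * h) a :=
          pos_of_mul_pos_right (zero_lt_one.trans_le (hY σ hσ)) (by positivity)
        rw [mul_div_assoc', div_lt_iff₀ hX]
        calc 5 * l < 8 * l := by gcongr; norm_num
          _ = 8 * l * 1 := by ring
          _ ≤ 8 * l * (η ^ 4 * invNormSq (transferB lam E N σ * h) a) := by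
            gcongr; exact hY σ hσ
          _ = 8 * η * (η ^ 3 * l * invNormSq (transferB lam E N σ * h) a) := by ring
          _ ≤ 1 * (η ^ 3 * l * invNormSq (transferB lam E N σ * h) a) := by
            gcongr
            linarith [S.eta_le]
          _ = _ := one_mul _
    _ ≤ _ := by
        rw [Finset.sum_const, nsmul_eq_mul]
        gcongr

lemma exists_mem_geometric_layer {r Y Y₀ : ℝ} {q : ℕ} (h0 : Y < Y₀) (hq : Y₀ * r ^ q ≤ Y) :
    ∃ i < q, Y < Y₀ * r ^ i ∧ Y₀ * r ^ (i + 1) ≤ Y := by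
  classical
  have hex : ∃ n, Y₀ * r ^ n ≤ Y := ⟨q, hq⟩
  have hne : Nat.find hex ≠ 0 := by
    intro h
    have := Nat.find_spec hex
    rw [h, pow_zero, mul_one] at this
    linarith
  obtain ⟨i, hi⟩ := Nat.exists_eq_succ_of_ne_zero hne
  refine ⟨i, ?_, ?_, ?_⟩
  · have := Nat.find_min' hex hq
    omega
  · have := Nat.find_min hex (m := i) (by omega)
    push Not at this
    exact this
  · have := Nat.find_spec hex
    rwa [hi] at this

lemma sum_le_of_cover {α ι : Type*} [Fintype α] (f : α → ENNReal) (A B : Finset α)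
    (I : Finset ι) (G : ι → Finset α) (hc : ∀ x, x ∈ A ∨ x ∈ B ∨ ∃ i ∈ I, x ∈ G i) :
    ∑ x, f x ≤ ∑ x ∈ A, f x + ∑ x ∈ B, f x + ∑ i ∈ I, ∑ x ∈ G i, f x := by
  classical
  have h1 : ∀ s : Finset α, ∑ x ∈ s, f x = ∑ x, if x ∈ s then f x else 0 := fun s => by
    rw [Finset.sum_ite_mem, Finset.univ_inter]
  rw [Finset.sum_congr rfl fun i _ => h1 (G i), Finset.sum_comm, h1 A, h1 B,
    ← Finset.sum_add_distrib, ← Finset.sum_add_distrib]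
  refine Finset.sum_le_sum fun x _ => ?_
  rcases hc x with h | h | ⟨i, hi, h⟩
  · rw [if_pos h, add_assoc]; exact le_self_add
  · rw [if_pos h, add_right_comm]; exact le_add_self
  · refine le_trans ?_ le_add_self
    have := Finset.single_le_sum (f := fun i => if x ∈ G i then f x else 0)
      (fun _ _ => zero_le) hi
    rwa [if_pos h] at this

lemma AdmissibleScale.sum_le (S : AdmissibleScale lam η K q N)
    {ν : Measure (AddCircle (2 * Real.pi))} {δ E a l : ℝ} (hδ : 0 < δ) (hE : |E| ≤ 2 - δ)
    (hKq : K = Real.exp ((4 * momentExp δ + 4) * q))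
    {h : Matrix (Fin 2) (Fin 2) ℝ} (hh : h.det = 1) (hhs : hs h * η ^ 6 ≤ 8) {j : Fin 2}
    (hp : 1 ≤ 2 * η ^ 6 * (h 0 j ^ 2 + h 1 j ^ 2)) (hl0 : 0 < l) (hl : l < lam) :
    ∑ σ, ν (tauMap (transferB lam E N σ * h) ⁻¹' arc a l) ≤
      2 ^ N * (ENNReal.ofReal (1 + q * classConst K (Real.exp (2 * q)) q) *
        (arcSupLt ν (η ^ 3 * l) + ENNReal.ofReal η * arcSupLe ν l +
          dilationSup ν (η ^ 3)⁻¹ (η ^ 6)⁻¹ l)) := by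
  classical
  have hη := S.eta_pos
  have hK := S.one_le_threshold
  set Q := Real.exp (2 * q) with hQdef
  have hQ : 1 ≤ Q := Real.one_le_exp (by positivity)
  set Y : (Fin N → Bool) → ℝ := fun σ => invNormSq (transferB lam E N σ * h) a with hY
  set bad : Finset (Fin N → Bool) :=
    Finset.univ.filter fun σ => ∃ n ≤ N, K < hsq lam E (pot σ) n with hbad
  have hgood : ∀ σ, σ ∉ bad → ∀ n ≤ N, hsq lam E (pot σ) n ≤ K := by
    intro σ hσ n hn
    simp only [hbad, Finset.mem_filter, Finset.mem_univ, true_and] at hσ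
    push Not at hσ
    exact hσ n hn
  set far : Finset (Fin N → Bool) :=
    Finset.univ.filter fun σ => σ ∉ bad ∧ 1 ≤ η ^ 4 * Y σ with hfar
  set t : ℕ → ℝ := fun i => (η ^ 2)⁻¹ * Real.exp (-(q * i)) with ht
  have ht2 : ∀ i, t i ^ 2 = (η ^ 4)⁻¹ * Q⁻¹ ^ i := by
    intro i
    rw [ht, hQdef, ← Real.exp_neg, ← Real.exp_nat_mul, mul_pow, ← Real.exp_nat_mul]
    congr 1
    · field_simp
    · congr 1; push_cast; ring
  set cls : ℕ → Finset (Fin N → Bool) := fun i =>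
    Finset.univ.filter fun σ => σ ∉ bad ∧ Y σ < t i ^ 2 ∧ t (i + 1) ^ 2 ≤ Y σ with hcls
  have hcover : ∀ σ, σ ∈ bad ∨ σ ∈ far ∨ ∃ i ∈ Finset.range q, σ ∈ cls i := by
    intro σ
    by_cases hb : σ ∈ bad
    · exact Or.inl hb
    by_cases hf : 1 ≤ η ^ 4 * Y σ
    · exact Or.inr (Or.inl (by simp [hfar, hb, hf]))
    push Not at hf
    have hhs0 : 0 ≤ hs h := by linarith [two_le_hs hh]
    have hY6 := (S.exists_arc (transferB_mul_det lam E σ hh) 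
      (S.hs_mul_le hhs (hgood σ hb N le_rfl)) hl0 hl a).1
    have h0 : Y σ < (η ^ 4)⁻¹ := by
      rw [← one_div, lt_div_iff₀ (by positivity)]
      linarith
    have hq : (η ^ 4)⁻¹ * Q⁻¹ ^ q ≤ Y σ := by
      have e1 : Q⁻¹ ^ q = Real.exp (-(q : ℝ) ^ 2) ^ 2 := by
        rw [hQdef, ← Real.exp_neg, ← Real.exp_nat_mul, ← Real.exp_nat_mul]
        congr 1; push_cast; ring
      have e2 : Real.exp (-(q : ℝ) ^ 2) ^ 2 ≤ η ^ 12 := by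
        calc _ ≤ lam ^ 2 := by gcongr; exact S.exp_le
          _ = η ^ 60 := by rw [S.lam_eq]; ring
          _ ≤ η ^ 12 := S.pow_le_pow (by norm_num)
      rw [e1]
      have e3 : (η ^ 4)⁻¹ * Real.exp (-(q : ℝ) ^ 2) ^ 2 ≤ η ^ 8 := by
        calc _ ≤ (η ^ 4)⁻¹ * η ^ 12 := by gcongr
          _ = η ^ 8 := by field_simp
      have e4 : η ^ 7 ≤ Y σ := by
        have h8K : 0 < 8 * K := by positivity
        refine le_of_mul_le_mul_left ?_ h8K
        calc 8 * K * η ^ 7 = 8 * K * η * η ^ 6 := by ring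
          _ ≤ 1 * η ^ 6 := by gcongr; exact S.threshold_mul_le
          _ = η ^ 6 := one_mul _
          _ ≤ _ := hY6
      exact e3.trans ((S.pow_le_pow (by norm_num)).trans e4)
    obtain ⟨i, hi, h1, h2⟩ := exists_mem_geometric_layer h0 hq
    refine Or.inr (Or.inr ⟨i, Finset.mem_range.2 hi, ?_⟩)
    simp only [hcls, Finset.mem_filter, Finset.mem_univ, true_and, ht2]
    exact ⟨hb, h1, h2⟩
  set S₁ := arcSupLt ν (η ^ 3 * l) with hS₁
  set S₂ := ENNReal.ofReal η * arcSupLe ν l with hS₂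
  set S₃ := dilationSup ν (η ^ 3)⁻¹ (η ^ 6)⁻¹ l with hS₃
  set W := classConst K Q q with hWdef
  have hW : 0 ≤ W := by rw [hWdef]; unfold classConst; positivity
  have hbadsum := S.sum_large_le (ν := ν) (a := a) hδ hE hKq hh hhs hl0 hl bad
    (by simp [hbad])
  have hfarsum := S.sum_contracting_le (ν := ν) (E := E) (a := a) hh hhs hl0 hl far
    (fun σ hσ => hgood σ (Finset.mem_filter.1 hσ).2.1) (fun σ hσ => (Finset.mem_filter.1 hσ).2.2)
  have hclsum : ∀ i, ∑ σ ∈ cls i, ν (tauMap (transferB lam E N σ * h) ⁻¹' arc a l) ≤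
      2 ^ N * (ENNReal.ofReal W * (S₂ + S₃)) := by
    intro i
    refine S.sum_class_le (t := t i) hh hhs hp hl0 hl hQ (by positivity) ?_ (cls i)
      (fun σ hσ => hgood σ (Finset.mem_filter.1 hσ).2.1) (fun σ hσ => ?_)
      (fun σ hσ => (Finset.mem_filter.1 hσ).2.2.1.le)
    · have : Real.exp (-((q : ℝ) * i)) ≤ 1 := Real.exp_le_one_iff.2 (by
        have : (0 : ℝ) ≤ q * i := by positivity
        linarith)
      calc t i * η ^ 2 = Real.exp (-(q * i)) := by simp only [ht]; field_simp
        _ ≤ 1 := this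
    · have h2 := (Finset.mem_filter.1 hσ).2.2.2
      have h3 : t i ^ 2 = Q * t (i + 1) ^ 2 := by
        rw [ht2, ht2, pow_succ Q⁻¹]
        linear_combination (-(η ^ 4)⁻¹ * Q⁻¹ ^ i) *
          mul_inv_cancel₀ (zero_lt_one.trans_le hQ).ne'
      rw [h3]
      gcongr
  have htot := sum_le_of_cover
    (fun σ => ν (tauMap (transferB lam E N σ * h) ⁻¹' arc a l)) bad far (Finset.range q) cls hcover
  refine htot.trans ?_
  calc _ ≤ 2 ^ N * S₂ + 2 ^ N * S₁ + ∑ i ∈ Finset.range q,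
        2 ^ N * (ENNReal.ofReal W * (S₂ + S₃)) :=
        add_le_add (add_le_add hbadsum hfarsum) (Finset.sum_le_sum fun i _ => hclsum i)
    _ = 2 ^ N * (S₁ + S₂ + q * (ENNReal.ofReal W * (S₂ + S₃))) := by
        rw [Finset.sum_const, Finset.card_range, nsmul_eq_mul]; ring
    _ ≤ 2 ^ N * ((S₁ + S₂ + S₃) + q * (ENNReal.ofReal W * (S₁ + S₂ + S₃))) := by
        gcongr 2 ^ N * (?_ + q * (ENNReal.ofReal W * (?_ + S₃)))
        · exact le_self_add
        · exact le_add_self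
    _ = _ := by
        rw [ENNReal.ofReal_add zero_le_one (by positivity), ENNReal.ofReal_one,
          ENNReal.ofReal_mul (by positivity), ENNReal.ofReal_natCast]
        ring

end Assembly

section Conclusion

lemma exists_admissibleScale {A lam : ℝ} (hA : 0 ≤ A) (hlam : 0 < lam)
    (hlam0 : lam < Real.exp (-(60 * A + 90) ^ 2)) :
    ∃ q : ℕ, (q : ℝ) ≤ 2 * √|Real.log lam| ∧
      AdmissibleScale lam (lam ^ ((1 : ℝ) / 30)) (Real.exp (A * q)) q ⌈(lam ^ 2)⁻¹⌉₊ := by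
  set L := |Real.log lam| with hL
  have hlog : Real.log lam < -(60 * A + 90) ^ 2 := (Real.log_lt_iff_lt_exp hlam).2 hlam0
  have hLlog : Real.log lam = -L := by
    rw [hL, abs_of_nonpos (by linarith [sq_nonneg (60 * A + 90)]), neg_neg]
  have hL0 : 0 ≤ L := abs_nonneg _
  have hs : 60 * A + 90 ≤ √L := Real.le_sqrt_of_sq_le (by linarith)
  have hss : √L ^ 2 = L := Real.sq_sqrt hL0
  set q := ⌈√L⌉₊ with hq
  have hq1 : √L ≤ q := Nat.le_ceil _
  have hq2 : (q : ℝ) < √L + 1 := Nat.ceil_lt_add_one (Real.sqrt_nonneg _)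
  have hexp : lam = Real.exp (-L) := by rw [← hLlog, Real.exp_log hlam]
  have hl2 : lam ^ 2 ≤ 1 := by
    refine pow_le_one₀ hlam.le ?_
    rw [hexp, Real.exp_le_one_iff]
    linarith
  have hl20 : 0 < lam ^ 2 := by positivity
  have hN1 : (lam ^ 2)⁻¹ ≤ (⌈(lam ^ 2)⁻¹⌉₊ : ℝ) := Nat.le_ceil _
  have hN2 : (⌈(lam ^ 2)⁻¹⌉₊ : ℝ) < (lam ^ 2)⁻¹ + 1 := Nat.ceil_lt_add_one (by positivity)
  have hinv : (lam ^ 2)⁻¹ * lam ^ 2 = 1 := inv_mul_cancel₀ hl20.ne'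
  refine ⟨q, by linarith, ?_, ?_, ?_, ?_, ?_, ?_, ?_, ?_⟩
  · positivity
  · rw [← Real.rpow_natCast, ← Real.rpow_mul hlam.le]
    norm_num
  · exact Real.one_le_exp (by positivity)
  · have h8 : (8 : ℝ) ≤ Real.exp 3 := by
      have := pow_le_pow_left₀ (by norm_num) Real.exp_one_gt_two.le 3
      rw [← Real.exp_nat_mul] at this
      norm_num at this
      exact this
    have hη : lam ^ ((1 : ℝ) / 30) = Real.exp (-L * (1 / 30)) := by
      rw [Real.rpow_def_of_pos hlam, hLlog]
    rw [hη]
    calc _ ≤ Real.exp 3 * Real.exp (A * q) * Real.exp (-L * (1 / 30)) := by gcongr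
      _ = Real.exp (3 + A * q - L / 30) := by rw [← Real.exp_add, ← Real.exp_add]; ring_nf
      _ ≤ 1 := by
        rw [Real.exp_le_one_iff]
        have h1 : A * q ≤ A * (2 * √L) := by gcongr; linarith
        have h2 : (60 * A + 90) * √L ≤ √L * √L := by gcongr
        nlinarith
  · have : (0 : ℝ) < q := by linarith
    exact_mod_cast this
  · rw [hexp, Real.exp_le_exp]
    have : √L ^ 2 ≤ (q : ℝ) ^ 2 := by gcongr
    linarith
  · rw [← hinv]
    gcongr
  · have : (⌈(lam ^ 2)⁻¹⌉₊ : ℝ) * lam ^ 2 ≤ ((lam ^ 2)⁻¹ + 1) * lam ^ 2 := by gcongr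
    linarith

lemma one_add_mul_classConst_le {A : ℝ} {q : ℕ} (hA : 0 ≤ A) (hq : 1 ≤ q) :
    1 + q * classConst (Real.exp (A * q)) (Real.exp (2 * q)) q ≤
      Real.exp ((20 + 5 * A) * q) := by
  have hq' : (1 : ℝ) ≤ q := by exact_mod_cast hq
  have hqe : (q : ℝ) ≤ Real.exp q := by linarith [Real.add_one_le_exp (q : ℝ)]
  have h16 : (5561005 : ℝ) ≤ Real.exp (16 * q) := by
    have h1 : (2.7 : ℝ) ^ 16 ≤ Real.exp 1 ^ 16 :=
      pow_le_pow_left₀ (by norm_num) (by linarith [Real.exp_one_gt_d9]) 16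
    rw [← Real.exp_nat_mul] at h1
    have h2 : Real.exp ((16 : ℕ) * 1) ≤ Real.exp (16 * q) := by
      rw [Real.exp_le_exp]
      push_cast
      linarith
    refine le_trans ?_ (h1.trans h2)
    norm_num
  set R := Real.exp (A * q) ^ 5 * Real.exp (2 * q) with hR
  have hR1 : 1 ≤ R := one_le_mul_of_one_le_of_one_le
    (one_le_pow₀ (Real.one_le_exp (by positivity))) (Real.one_le_exp (by positivity))
  have hqR : 1 ≤ (q : ℝ) ^ 2 * R := one_le_mul_of_one_le_of_one_le (one_le_pow₀ hq') hR1
  calc 1 + q * classConst (Real.exp (A * q)) (Real.exp (2 * q)) q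
      = 1 + 5561004 * ((q : ℝ) ^ 2 * R) := by unfold classConst; ring
    _ ≤ 5561005 * ((q : ℝ) ^ 2 * R) := by linarith
    _ ≤ Real.exp (16 * q) * (Real.exp q ^ 2 * R) := by gcongr
    _ = _ := by
      rw [hR, ← Real.exp_nat_mul, ← Real.exp_nat_mul, ← Real.exp_add, ← Real.exp_add,
        ← Real.exp_add]
      congr 1
      push_cast
      ring

lemma exists_column_ge (h : Matrix (Fin 2) (Fin 2) ℝ) :
    ∃ j, hs h ≤ 2 * (h 0 j ^ 2 + h 1 j ^ 2) := by
  unfold hs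
  rcases le_total (h 0 0 ^ 2 + h 1 0 ^ 2) (h 0 1 ^ 2 + h 1 1 ^ 2) with hle | hle
  · exact ⟨1, by linarith⟩
  · exact ⟨0, by linarith⟩

end Conclusion

/-- **Lemma 4.** For `δ₀ < |E| < 2 - δ₀`, small `λ`, `N = ⌈λ⁻²⌉`, any
`h ∈ SL₂(ℝ)` with `λ^{-1/10} ≤ ‖h‖ ≤ 2λ^{-1/10}`, and any arc `I` with `|I| < λ`,
`∫ (τ_{M_N(ε)h})_*[ν](I) dε` is bounded by
`e^{C|log λ|^{1/2}} { max_{|J|<λ^{1/10}|I|} ν(J) + λ^{1/30} max_{|J|≤|I|} ν(J)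
  + max_{λ^{-1/10}<D<λ^{-1/5}} D⁻¹ max_{|J|<D|I|} ν(J) }`. -/
theorem furstenberg_convolved_arc_bound
    (δ₀ : ℝ) (hδ₀ : 0 < δ₀) (hδ₀' : δ₀ < 1) (E : ℝ)
    (hE : δ₀ < |E|) (hE' : |E| < 2 - δ₀) :
    ∃ C lam0 : ℝ, 0 < C ∧ 0 < lam0 ∧
      ∀ lam : ℝ, 0 < lam → lam < lam0 →
        ∀ ν : Measure (AddCircle (2 * Real.pi)),
          IsProbabilityMeasure ν → Stationary lam E ν →
          ∀ h : Matrix (Fin 2) (Fin 2) ℝ, h.det = 1 →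
            lam ^ (-(1 : ℝ) / 10) ≤ opNorm h → opNorm h ≤ 2 * lam ^ (-(1 : ℝ) / 10) →
            ∀ a l : ℝ, l < lam →
              (∑ σ : Fin (⌈(lam ^ 2)⁻¹⌉₊) → Bool,
                  ν (tauMap (transferB lam E (⌈(lam ^ 2)⁻¹⌉₊) σ * h) ⁻¹' arc a l)) /
                  2 ^ (⌈(lam ^ 2)⁻¹⌉₊) ≤
                ENNReal.ofReal (Real.exp (C * Real.sqrt |Real.log lam|)) *
                  (arcSupLt ν (lam ^ ((1 : ℝ) / 10) * l) +
                    ENNReal.ofReal (lam ^ ((1 : ℝ) / 30)) * arcSupLe ν l +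
                    ⨆ (D : ℝ) (_ : D ∈ Set.Ioo (lam ^ (-(1 : ℝ) / 10)) (lam ^ (-(1 : ℝ) / 5))),
                      ENNReal.ofReal D⁻¹ * arcSupLt ν (D * l)) := by
  set A := 4 * momentExp δ₀ + 4 with hA
  have hA0 : 0 ≤ A := by rw [hA]; unfold momentExp; positivity
  refine ⟨2 * (20 + 5 * A), Real.exp (-(60 * A + 90) ^ 2), by positivity, by positivity, ?_⟩
  intro lam hlam hlam0 ν _ _ h hh hlow hup a l hl
  rcases le_or_gt l 0 with hl0 | hl0
  · have : arc a l = ∅ := by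
      rw [arc, Set.Ioo_eq_empty (by linarith), Set.image_empty]
    simp [this]
  obtain ⟨q, hq, S⟩ := exists_admissibleScale hA0 hlam hlam0
  set η := lam ^ ((1 : ℝ) / 30) with hη
  set N := ⌈(lam ^ 2)⁻¹⌉₊
  have hη0 := S.eta_pos
  have e3 : lam ^ ((1 : ℝ) / 10) = η ^ 3 := by
    rw [hη, ← Real.rpow_natCast, ← Real.rpow_mul hlam.le]; norm_num
  have e3' : lam ^ (-(1 : ℝ) / 10) = (η ^ 3)⁻¹ := by
    rw [← e3, ← Real.rpow_neg hlam.le]; norm_num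
  have e6' : lam ^ (-(1 : ℝ) / 5) = (η ^ 6)⁻¹ := by
    rw [hη, ← Real.rpow_natCast, ← Real.rpow_mul hlam.le, ← Real.rpow_neg hlam.le]; norm_num
  rw [e3'] at hlow hup
  have hη3 : (η ^ 3)⁻¹ * η ^ 3 = 1 := inv_mul_cancel₀ (by positivity)
  have hhs : hs h * η ^ 6 ≤ 8 := by
    have h0 := column_normSq_le_opNorm_sq h 0
    have h1 := column_normSq_le_opNorm_sq h 1
    have h2 : hs h ≤ 2 * opNorm h ^ 2 := by unfold hs; linarith
    have h3 : 0 ≤ opNorm h := norm_nonneg _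
    calc hs h * η ^ 6 ≤ 2 * (2 * (η ^ 3)⁻¹) ^ 2 * η ^ 6 := by
          gcongr
          exact h2.trans (by gcongr)
      _ = 8 * ((η ^ 3)⁻¹ * η ^ 3) ^ 2 := by ring
      _ = 8 := by rw [hη3]; norm_num
  obtain ⟨j, hj⟩ := exists_column_ge h
  have hp : 1 ≤ 2 * η ^ 6 * (h 0 j ^ 2 + h 1 j ^ 2) := by
    calc 1 = ((η ^ 3)⁻¹ * η ^ 3) ^ 2 := by rw [hη3]; norm_num
      _ = η ^ 6 * (η ^ 3)⁻¹ ^ 2 := by ring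
      _ ≤ η ^ 6 * opNorm h ^ 2 := by gcongr
      _ ≤ η ^ 6 * (2 * (h 0 j ^ 2 + h 1 j ^ 2)) := by
        gcongr
        exact (opNorm_sq_le_hs h).trans hj
      _ = _ := by ring
  have main := S.sum_le (ν := ν) (E := E) (a := a) hδ₀ hE'.le rfl hh hhs hp hl0 hl
  rw [e3, e3', e6']
  refine ENNReal.div_le_of_le_mul' (main.trans ?_)
  unfold dilationSup
  gcongr
  refine (one_add_mul_classConst_le hA0 S.one_le_moment).trans ?_
  rw [Real.exp_le_exp]
  have := mul_le_mul_of_nonneg_left hq (by positivity : 0 ≤ 20 + 5 * A)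
  linarith
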